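/- arXiv:math/0505529 — 12 statements merged into one kernel-verified Lean document; each statement's English description precedes it below -/
import Mathlib

section
/- For every real number λ and every ε > 0, one has 2·max(λ,0) + ∫_ε^∞ (2π)^{-1/2} x^{-3/2} e^{-λ²x/2} dx = (2/π)^{1/2} ε^{-1/2} + λ + ∫_0^ε (2π)^{-1/2} x^{-3/2} (1 − e^{-λ²x/2}) dx. -/
open MeasureTheory Real

lemma aux_intK0 (b ε : ℝ) (hb : 0 < b) (hε : 0 < ε) :
    IntegrableOn (fun x : ℝ => x ^ (-(3/2 : ℝ)) * (1 - Real.exp (-b * x))) (Set.Ioc 0 ε) := by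
  have h1 : IntegrableOn (fun x : ℝ => b * x ^ (-(1/2 : ℝ))) (Set.Ioc 0 ε) := by
    have := (intervalIntegral.intervalIntegrable_rpow' (a := 0) (b := ε) (r := -(1/2 : ℝ))
      (by norm_num)).const_mul b
    rwa [intervalIntegrable_iff_integrableOn_Ioc_of_le hε.le] at this
  refine Integrable.mono' h1 (by fun_prop) ?_
  refine (ae_restrict_iff' measurableSet_Ioc).2 (Filter.Eventually.of_forall ?_)
  intro x hx
  have hx0 : 0 < x := hx.1
  have e1 : 1 - Real.exp (-b * x) ≤ b * x := by
    have := Real.add_one_le_exp (-b * x); linarith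
  have e2 : 0 ≤ 1 - Real.exp (-b * x) := by
    have : Real.exp (-b * x) ≤ 1 := Real.exp_le_one_iff.2 (by nlinarith)
    linarith
  have e3 : x ^ (-(1/2 : ℝ)) = x ^ (-(3/2 : ℝ)) * x := by
    nth_rewrite 3 [← Real.rpow_one x]
    rw [← Real.rpow_add hx0]; norm_num
  have e4 : 0 ≤ x ^ (-(3/2 : ℝ)) := by positivity
  rw [Real.norm_of_nonneg (mul_nonneg e4 e2), e3]
  nlinarith [mul_le_mul_of_nonneg_left e1 e4]

lemma aux_intK1 (b ε : ℝ) (hb : 0 ≤ b) (hε : 0 < ε) :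
    IntegrableOn (fun x : ℝ => x ^ (-(3/2 : ℝ)) * (1 - Real.exp (-b * x))) (Set.Ioi ε) := by
  refine Integrable.mono' (integrableOn_Ioi_rpow_of_lt (a := -(3/2 : ℝ)) (by norm_num) hε)
    (by fun_prop) ?_
  refine (ae_restrict_iff' measurableSet_Ioi).2 (Filter.Eventually.of_forall ?_)
  intro x hx
  have hx0 : 0 < x := lt_trans hε hx
  have e2 : 0 ≤ 1 - Real.exp (-b * x) := by
    have : Real.exp (-b * x) ≤ 1 := Real.exp_le_one_iff.2 (by nlinarith)
    linarith
  have e4 : 0 ≤ x ^ (-(3/2 : ℝ)) := by positivity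
  rw [Real.norm_of_nonneg (mul_nonneg e4 e2)]
  have := Real.exp_pos (-b * x)
  nlinarith

lemma aux_total (b : ℝ) (hb : 0 < b) :
    ∫ x in Set.Ioi (0:ℝ), x ^ (-(3/2 : ℝ)) * (1 - Real.exp (-b * x)) =
      2 * b * ((1 / b) ^ (1/2 : ℝ) * √π) := by
  have hK : IntegrableOn (fun x : ℝ => x ^ (-(3/2 : ℝ)) * (1 - Real.exp (-b * x)))
      (Set.Ioi 0) := by
    rw [← Set.Ioc_union_Ioi_eq_Ioi (zero_le_one (α := ℝ))]
    exact (aux_intK0 b 1 hb one_pos).union (aux_intK1 b 1 hb.le one_pos)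
  have hE : IntegrableOn (fun x : ℝ => x ^ (-(1/2 : ℝ)) * Real.exp (-b * x)) (Set.Ioi 0) := by
    have := integrableOn_rpow_mul_exp_neg_mul_rpow (p := 1) (s := -(1/2:ℝ)) (b := b)
      (by norm_num) (by norm_num) hb
    simpa using this
  have hG := Real.integral_rpow_mul_exp_neg_mul_Ioi (a := 1/2) (r := b) (by norm_num) hb
  rw [Real.Gamma_one_half_eq] at hG
  have hG' : ∫ x in Set.Ioi (0:ℝ), x ^ (-(1/2 : ℝ)) * Real.exp (-b * x)
      = (1 / b) ^ (1/2 : ℝ) * √π := by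
    rw [← hG]; norm_num
  have hb0 : ∀ x : ℝ, 0 ≤ x → 0 ≤ 1 - Real.exp (-b * x) := fun x hx => by
    have : Real.exp (-b * x) ≤ 1 := Real.exp_le_one_iff.2 (by nlinarith)
    linarith
  have ftc := integral_Ioi_of_hasDerivAt_of_tendsto (a := 0) (m := 0)
    (f := fun x : ℝ => -2 * (x ^ (-(1/2 : ℝ)) * (1 - Real.exp (-b * x))))
    (f' := fun x : ℝ => x ^ (-(3/2 : ℝ)) * (1 - Real.exp (-b * x))
      - 2 * b * (x ^ (-(1/2 : ℝ)) * Real.exp (-b * x))) ?_ ?_ ?_ ?_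
  · rw [integral_sub hK (hE.const_mul _), integral_const_mul, hG'] at ftc
    simp at ftc
    simp
    linarith
  · unfold ContinuousWithinAt
    have h0 : Filter.Tendsto (fun x : ℝ => 2 * b * x ^ (1/2:ℝ)) (nhdsWithin 0 (Set.Ici 0))
        (nhds 0) := by
      have : ContinuousAt (fun x : ℝ => 2 * b * x ^ (1/2:ℝ)) 0 :=
        continuousAt_const.mul (Real.continuousAt_rpow_const _ _ (Or.inr (by norm_num)))
      have h := this.tendsto.mono_left (nhdsWithin_le_nhds (s := Set.Ici 0))
      simpa using h
    simp only [mul_zero, Real.exp_zero, sub_self]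
    refine squeeze_zero_norm' ?_ h0
    filter_upwards [self_mem_nhdsWithin] with x hx
    rcases eq_or_lt_of_le (show (0:ℝ) ≤ x from hx) with h | h
    · subst h; simp
    · have e1 : 1 - Real.exp (-b * x) ≤ b * x := by
        have := Real.add_one_le_exp (-b * x); linarith
      have e3 : x ^ (1/2 : ℝ) = x ^ (-(1/2 : ℝ)) * x := by
        nth_rewrite 3 [← Real.rpow_one x]
        rw [← Real.rpow_add h]; norm_num
      have e4 : 0 ≤ x ^ (-(1/2 : ℝ)) := by positivity
      rw [norm_mul, Real.norm_of_nonneg (mul_nonneg e4 (hb0 x h.le)), e3, show ‖(-2:ℝ)‖ = 2 by norm_num]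
      nlinarith [mul_le_mul_of_nonneg_left e1 e4]
  · intro x hx
    have hx0 : (0:ℝ) < x := hx
    have d1 := Real.hasDerivAt_rpow_const (x := x) (p := -(1/2:ℝ)) (Or.inl hx0.ne')
    have d2 : HasDerivAt (fun x : ℝ => 1 - Real.exp (-b * x)) (b * Real.exp (-b * x)) x := by
      have := (((hasDerivAt_id x).const_mul (-b)).exp).const_sub 1
      refine this.congr_deriv ?_
      simp; ring
    refine ((d1.mul d2).const_mul (-2)).congr_deriv ?_
    rw [show (-(1/2:ℝ) - 1) = -(3/2) by norm_num]
    ring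
  · exact hK.sub (hE.const_mul _)
  · have h0 : Filter.Tendsto (fun x : ℝ => 2 * x ^ (-(1/2:ℝ))) Filter.atTop (nhds 0) := by
      simpa using (tendsto_rpow_neg_atTop (y := 1/2) (by norm_num)).const_mul 2
    refine squeeze_zero_norm' ?_ h0
    filter_upwards [Filter.eventually_gt_atTop 0] with x h
    have e4 : 0 ≤ x ^ (-(1/2 : ℝ)) := by positivity
    rw [norm_mul, Real.norm_of_nonneg (mul_nonneg e4 (hb0 x h.le)), show ‖(-2:ℝ)‖ = 2 by norm_num]
    have := Real.exp_pos (-b * x)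
    nlinarith

lemma aux_const (l : ℝ) (hl : l ≠ 0) :
    (2 * π) ^ (-(1/2 : ℝ)) * (2 * (l^2/2) * ((1 / (l^2/2)) ^ (1/2 : ℝ) * √π)) = |l| := by
  have hp := Real.pi_pos
  rw [Real.rpow_neg (by positivity), ← Real.sqrt_eq_rpow, ← Real.sqrt_eq_rpow,
    Real.sqrt_mul (by norm_num), Real.sqrt_div (by norm_num), Real.sqrt_div (by positivity),
    Real.sqrt_sq_eq_abs, ← sq_abs l]
  have : 0 < |l| := abs_pos.2 hl
  have h2 : (0:ℝ) < √2 := by positivity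
  have h3 : 0 < √π := by positivity
  field_simp
  simp

lemma aux_K (l ε : ℝ) (hε : 0 < ε) :
    (2 * π) ^ (-(1/2 : ℝ)) * ((∫ x in Set.Ioc 0 ε, x ^ (-(3/2 : ℝ)) * (1 - Real.exp (-(l^2/2) * x)))
     + ∫ x in Set.Ioi ε, x ^ (-(3/2 : ℝ)) * (1 - Real.exp (-(l^2/2) * x))) = |l| := by
  by_cases hl : l = 0
  · subst hl; simp
  have hb : 0 < l^2/2 := by positivity
  rw [← setIntegral_union (Set.Ioc_disjoint_Ioi le_rfl) measurableSet_Ioi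
    (aux_intK0 _ ε hb hε) (aux_intK1 _ ε hb.le hε), Set.Ioc_union_Ioi_eq_Ioi hε.le,
    aux_total _ hb, aux_const l hl]

theorem stmt_0 (l ε : ℝ) (hε : 0 < ε) :
    2 * max l 0 +
      ∫ x in Set.Ioi ε,
        (2 * π) ^ (-(1/2 : ℝ)) * x ^ (-(3/2 : ℝ)) * Real.exp (-(l ^ 2) * x / 2) =
    (2 / π) ^ ((1/2 : ℝ)) * ε ^ (-(1/2 : ℝ)) + l +
      ∫ x in Set.Ioo 0 ε,
        (2 * π) ^ (-(1/2 : ℝ)) * x ^ (-(3/2 : ℝ)) * (1 - Real.exp (-(l ^ 2) * x / 2)) := by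
  have hK := aux_K l ε hε
  have hx : ∀ x : ℝ, -(l ^ 2) * x / 2 = -(l^2/2) * x := fun x => by ring
  simp only [hx, mul_assoc ((2 * π) ^ (-(1/2 : ℝ))), integral_const_mul]
  rw [← integral_Ioc_eq_integral_Ioo]
  have hR := integrableOn_Ioi_rpow_of_lt (a := -(3/2 : ℝ)) (by norm_num) hε
  have h1 : ∫ x in Set.Ioi ε, x ^ (-(3/2 : ℝ)) * Real.exp (-(l^2/2) * x) =
      (∫ x in Set.Ioi ε, x ^ (-(3/2 : ℝ))) -
        ∫ x in Set.Ioi ε, x ^ (-(3/2 : ℝ)) * (1 - Real.exp (-(l^2/2) * x)) := by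
    rw [← integral_sub hR (aux_intK1 _ ε (by positivity) hε)]
    congr 1; ext x; ring
  rw [h1, integral_Ioi_rpow_of_lt (by norm_num) hε]
  have h2 : (2 / π) ^ ((1/2 : ℝ)) = (2 * π) ^ (-(1/2 : ℝ)) * 2 := by
    have hp := Real.pi_pos
    rw [Real.rpow_neg (by positivity), ← Real.sqrt_eq_rpow, ← Real.sqrt_eq_rpow,
      Real.sqrt_mul (by norm_num), Real.sqrt_div (by norm_num)]
    field_simp
    simp
  have h3 : 2 * max l 0 = l + |l| := by
    rcases le_total l 0 with h | h
    · rw [max_eq_right h, abs_of_nonpos h]; ring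
    · rw [max_eq_left h, abs_of_nonneg h]; ring
  rw [h2, h3, ← hK, show (-(3/2:ℝ) + 1) = -(1/2) by norm_num]
  ring
end

section
/- There is an absolute constant C such that for every real number λ and every ε > 0, |u_ε(λ) − ((2/π)^{1/2} ε^{-1/2} + λ + (2π)^{-1/2} λ² ε^{1/2})| ≤ C λ⁴ ε^{3/2}, where u_ε(λ) := 2·max(λ,0) + ∫_ε^∞ (2π)^{-1/2} x^{-3/2} e^{-λ²x/2} dx. -/
open MeasureTheory Real

lemma aux_rpow (x : ℝ) (hx : 0 < x) : x ^ (-(1/2 : ℝ)) = (√x)⁻¹ ∧ x ^ (1/2 : ℝ) = √x ∧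
    x ^ (3/2 : ℝ) = √x ^ 3 := by
  refine ⟨?_, ?_, ?_⟩
  · rw [Real.rpow_neg hx.le, Real.sqrt_eq_rpow]
  · rw [Real.sqrt_eq_rpow]
  · rw [Real.sqrt_eq_rpow, ← Real.rpow_natCast, ← Real.rpow_mul hx.le]; norm_num

lemma aux_int32 (a ε : ℝ) (ha : 0 ≤ a) (hε : 0 < ε) :
    IntegrableOn (fun x : ℝ => x ^ (-(3/2 : ℝ)) * Real.exp (-(a * x))) (Set.Ioi ε) := by
  have h1 : IntegrableOn (fun x : ℝ => x ^ (-(3/2 : ℝ))) (Set.Ioi ε) :=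
    integrableOn_Ioi_rpow_of_lt (by norm_num) hε
  refine Integrable.mono h1 ?_ ?_
  · exact h1.aestronglyMeasurable.mul (by fun_prop)
  · refine (ae_restrict_mem measurableSet_Ioi).mono fun x hx => ?_
    have hx0 : 0 < x := hε.trans hx
    rw [norm_mul]
    refine mul_le_of_le_one_right (norm_nonneg _) ?_
    rw [Real.norm_eq_abs, abs_of_pos (Real.exp_pos _), Real.exp_le_one_iff]
    have := mul_nonneg ha hx0.le
    linarith

lemma aux_int12 (a : ℝ) (ha : 0 < a) :
    IntegrableOn (fun x : ℝ => x ^ (-(1/2 : ℝ)) * Real.exp (-(a * x))) (Set.Ioi 0) := by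
  have := integrableOn_rpow_mul_exp_neg_mul_rpow (p := 1) (s := -(1/2)) (b := a)
    (by norm_num) (by norm_num) ha
  simpa using this

lemma aux_gamma (a : ℝ) (ha : 0 < a) :
    ∫ x in Set.Ioi (0:ℝ), x ^ (-(1/2 : ℝ)) * Real.exp (-(a * x)) = √(π / a) := by
  have := Real.integral_rpow_mul_exp_neg_mul_Ioi (a := 1/2) (r := a) (by norm_num) ha
  rw [Real.Gamma_one_half_eq, show (1/2 - 1 : ℝ) = -(1/2) by norm_num] at this
  rw [this, ← Real.sqrt_eq_rpow, ← Real.sqrt_mul (by positivity)]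
  congr 1; ring

lemma aux_parts (a ε : ℝ) (ha : 0 < a) (hε : 0 < ε) :
    (∫ x in Set.Ioi ε, x ^ (-(3/2 : ℝ)) * Real.exp (-(a * x))) +
      2 * a * ∫ x in Set.Ioi ε, x ^ (-(1/2 : ℝ)) * Real.exp (-(a * x)) =
      2 * ε ^ (-(1/2 : ℝ)) * Real.exp (-(a * ε)) := by
  have i1 := aux_int32 a ε ha.le hε
  have i2 : IntegrableOn (fun x : ℝ => x ^ (-(1/2 : ℝ)) * Real.exp (-(a * x))) (Set.Ioi ε) :=
    (aux_int12 a ha).mono_set (Set.Ioi_subset_Ioi hε.le)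
  rw [← integral_const_mul, ← integral_add i1 (i2.const_mul _)]
  have hd : ∀ x ∈ Set.Ici ε, HasDerivAt (fun x : ℝ => -2 * x ^ (-(1/2 : ℝ)) * Real.exp (-(a * x)))
      (x ^ (-(3/2 : ℝ)) * Real.exp (-(a * x)) + 2 * a * (x ^ (-(1/2 : ℝ)) * Real.exp (-(a * x)))) x := by
    intro x hx
    have hx0 : 0 < x := lt_of_lt_of_le hε hx
    have h1 := (Real.hasDerivAt_rpow_const (x := x) (p := -(1/2)) (Or.inl hx0.ne')).const_mul (-2)
    have h2 := (((hasDerivAt_id x).const_mul a).neg).exp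
    refine (h1.mul h2).congr_deriv ?_
    rw [show (-(1/2) - 1 : ℝ) = -(3/2) by norm_num]
    simp
    ring
  have ht : Filter.Tendsto (fun x : ℝ => -2 * x ^ (-(1/2 : ℝ)) * Real.exp (-(a * x))) Filter.atTop
      (nhds 0) := by
    have h1 := tendsto_rpow_neg_atTop (y := 1/2) (by norm_num)
    have h2 : Filter.Tendsto (fun x : ℝ => Real.exp (-(a * x))) Filter.atTop (nhds 0) :=
      Real.tendsto_exp_neg_atTop_nhds_zero.comp (Filter.tendsto_id.const_mul_atTop ha)
    simpa using (h1.const_mul (-2)).mul h2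
  rw [integral_Ioi_of_hasDerivAt_of_tendsto' hd (i1.add (i2.const_mul _)) ht]
  ring

lemma aux_J (a ε : ℝ) (ha : 0 < a) (hε : 0 < ε) :
    2 * √ε - a * (2/3 * √ε ^ 3) ≤ (∫ x in (0:ℝ)..ε, x ^ (-(1/2 : ℝ)) * Real.exp (-(a * x))) ∧
    (∫ x in (0:ℝ)..ε, x ^ (-(1/2 : ℝ)) * Real.exp (-(a * x))) ≤ 2 * √ε := by
  obtain ⟨-, e2, e3⟩ := aux_rpow ε hε
  have j1 : IntervalIntegrable (fun x : ℝ => x ^ (-(1/2 : ℝ))) volume 0 ε :=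
    intervalIntegral.intervalIntegrable_rpow' (by norm_num)
  have j2 : IntervalIntegrable (fun x : ℝ => x ^ ((1/2 : ℝ))) volume 0 ε :=
    intervalIntegral.intervalIntegrable_rpow' (by norm_num)
  have j3 : IntervalIntegrable (fun x : ℝ => x ^ (-(1/2 : ℝ)) * Real.exp (-(a * x))) volume 0 ε :=
    (intervalIntegrable_iff_integrableOn_Ioc_of_le hε.le).2
      ((aux_int12 a ha).mono_set Set.Ioc_subset_Ioi_self)
  have k1 : ∫ x in (0:ℝ)..ε, x ^ (-(1/2 : ℝ)) = 2 * √ε := by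
    rw [integral_rpow (Or.inl (by norm_num)), show (-(1/2) + 1 : ℝ) = 1/2 by norm_num, e2,
      Real.zero_rpow (by norm_num)]
    ring
  have k2 : ∫ x in (0:ℝ)..ε, x ^ ((1/2 : ℝ)) = 2/3 * √ε ^ 3 := by
    rw [integral_rpow (Or.inl (by norm_num)), show ((1/2) + 1 : ℝ) = 3/2 by norm_num, e3,
      Real.zero_rpow (by norm_num)]
    ring
  constructor
  · rw [← k1, ← k2, ← intervalIntegral.integral_const_mul,
      ← intervalIntegral.integral_sub j1 (j2.const_mul a)]
    refine intervalIntegral.integral_mono_on_of_le_Ioo hε.le (j1.sub (j2.const_mul a)) j3 ?_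
    intro x hx
    obtain ⟨f1, f2, -⟩ := aux_rpow x hx.1
    have hs := Real.sqrt_pos.2 hx.1
    have : √x = (√x)⁻¹ * x := by
      rw [eq_inv_mul_iff_mul_eq₀ hs.ne']; exact Real.mul_self_sqrt hx.1.le
    simp only [f1, f2]
    have h := mul_le_mul_of_nonneg_left (Real.add_one_le_exp (-(a * x))) (inv_pos.2 hs).le
    have e : (√x)⁻¹ - a * √x = (√x)⁻¹ * (-(a * x) + 1) := by
      linear_combination (-a) * this
    rw [e]; exact h
  · rw [← k1]
    refine intervalIntegral.integral_mono_on_of_le_Ioo hε.le j3 j1 ?_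
    intro x hx
    refine mul_le_of_le_one_right (Real.rpow_nonneg hx.1.le _) ?_
    rw [Real.exp_le_one_iff]
    have := mul_pos ha hx.1
    linarith

lemma aux_exp (y : ℝ) (hy : 0 ≤ y) : Real.exp (-y) ≤ 1 - y + y ^ 2 := by
  rw [Real.exp_neg]
  have h := Real.add_one_le_exp y
  have h1 : (Real.exp y)⁻¹ ≤ (y + 1)⁻¹ := inv_anti₀ (by positivity) h
  refine h1.trans ?_
  rw [inv_le_iff_one_le_mul₀ (by positivity)]
  nlinarith [pow_nonneg hy 3]

theorem stmt_1 :
    ∃ C : ℝ, ∀ l ε : ℝ, 0 < ε →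
      |(2 * max l 0 +
          ∫ x in Set.Ioi ε,
            (2 * π) ^ (-(1/2 : ℝ)) * x ^ (-(3/2 : ℝ)) * Real.exp (-(l ^ 2) * x / 2)) -
        ((2 / π) ^ ((1/2 : ℝ)) * ε ^ (-(1/2 : ℝ)) + l +
          (2 * π) ^ (-(1/2 : ℝ)) * l ^ 2 * ε ^ ((1/2 : ℝ)))| ≤
      C * l ^ 4 * ε ^ ((3/2 : ℝ)) := by
  refine ⟨(2 * π) ^ (-(1/2 : ℝ)), fun l ε hε => ?_⟩
  have hc : 0 < (2 * π) ^ (-(1/2 : ℝ)) := by positivity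
  have hc2 : (2 / π) ^ ((1/2 : ℝ)) = 2 * (2 * π) ^ (-(1/2 : ℝ)) := by
    rw [(aux_rpow (2 * π) (by positivity)).1, ← Real.sqrt_eq_rpow,
      Real.sqrt_eq_iff_mul_self_eq (by positivity) (by positivity)]
    have : √(2 * π) * √(2 * π) = 2 * π := Real.mul_self_sqrt (by positivity)
    have h0 : √(2 * π) ≠ 0 := by positivity
    field_simp
    nlinarith
  have hint : ∫ x in Set.Ioi ε,
      (2 * π) ^ (-(1/2 : ℝ)) * x ^ (-(3/2 : ℝ)) * Real.exp (-(l ^ 2) * x / 2) =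
      (2 * π) ^ (-(1/2 : ℝ)) *
        ∫ x in Set.Ioi ε, x ^ (-(3/2 : ℝ)) * Real.exp (-(l ^ 2 / 2 * x)) := by
    rw [← integral_const_mul]
    congr 1
    funext x
    rw [mul_assoc]
    congr 3
    ring
  rw [hint, hc2]
  obtain ⟨e1, e2, e3⟩ := aux_rpow ε hε
  have hs := Real.sqrt_pos.2 hε
  have hss : ε = √ε ^ 2 := (Real.sq_sqrt hε.le).symm
  rcases eq_or_ne l 0 with rfl | hl
  · have : ∫ x in Set.Ioi ε, x ^ (-(3/2 : ℝ)) * Real.exp (-((0:ℝ) ^ 2 / 2 * x)) =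
        2 * (√ε)⁻¹ := by
      simp only [ne_eq, OfNat.ofNat_ne_zero, not_false_eq_true, zero_pow, zero_div, zero_mul,
        neg_zero, Real.exp_zero, mul_one]
      rw [integral_Ioi_rpow_of_lt (by norm_num) hε, show (-(3/2) + 1 : ℝ) = -(1/2) by norm_num, e1]
      ring
    rw [this, e1]
    apply le_of_eq
    rw [abs_eq_zero.2]
    · simp
    · simp; ring
  have ha : 0 < l ^ 2 / 2 := by positivity
  have hp := aux_parts (l ^ 2 / 2) ε ha hε
  have hg := aux_gamma (l ^ 2 / 2) ha
  obtain ⟨hJ1, hJ2⟩ := aux_J (l ^ 2 / 2) ε ha hε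
  have hsplit := intervalIntegral.integral_interval_add_Ioi
    (f := fun x : ℝ => x ^ (-(1/2 : ℝ)) * Real.exp (-(l ^ 2 / 2 * x))) (μ := volume)
    (a := 0) (b := ε) (aux_int12 _ ha) ((aux_int12 _ ha).mono_set (Set.Ioi_subset_Ioi hε.le))
  rw [hg] at hsplit
  have hx1 := aux_exp (l ^ 2 / 2 * ε) (by positivity)
  have hx2 := Real.add_one_le_exp (-(l ^ 2 / 2 * ε))
  have habs : (2 * π) ^ (-(1/2 : ℝ)) * (l ^ 2 * √(π / (l ^ 2 / 2))) = |l| := by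
    have hl' : 0 < |l| := abs_pos.2 hl
    have : √(π / (l ^ 2 / 2)) = √(2 * π) / |l| := by
      rw [← Real.sqrt_sq_eq_abs, ← Real.sqrt_div' _ (sq_nonneg l)]
      congr 1; field_simp
    rw [this, (aux_rpow (2 * π) (by positivity)).1, ← sq_abs l]
    have h0 : √(2 * π) ≠ 0 := by positivity
    field_simp
  have hmax : 2 * max l 0 = l + |l| := by
    rcases le_total l 0 with h | h
    · rw [max_eq_right h, abs_of_nonpos h]; ring
    · rw [max_eq_left h, abs_of_nonneg h]; ring
  rw [e1] at hp
  rw [e1, e2, e3, hmax]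
  generalize (∫ x in Set.Ioi ε, x ^ (-(3/2 : ℝ)) * Real.exp (-(l ^ 2 / 2 * x))) = I at *
  generalize (∫ x in Set.Ioi ε, x ^ (-(1/2 : ℝ)) * Real.exp (-(l ^ 2 / 2 * x))) = K at *
  generalize (∫ x in (0:ℝ)..ε, x ^ (-(1/2 : ℝ)) * Real.exp (-(l ^ 2 / 2 * x))) = J at *
  generalize Real.exp (-(l ^ 2 / 2 * ε)) = X at *
  generalize √(π / (l ^ 2 / 2)) = G at *
  generalize (2 * π) ^ (-(1/2 : ℝ)) = c at *
  generalize √ε = s at *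
  subst hss
  have hD : (l + |l| + c * I) - (2 * c * s⁻¹ + l + c * l ^ 2 * s) =
      c * (2 * s⁻¹ * (X - 1 + l ^ 2 / 2 * s ^ 2) - l ^ 2 * (2 * s - J)) := by
    have hI : I = 2 * s⁻¹ * X - l ^ 2 * (G - J) := by linear_combination hp - l ^ 2 * hsplit
    rw [← habs, hI]
    field_simp
    ring
  rw [hD, abs_mul, abs_of_pos hc, mul_assoc c (l ^ 4)]
  refine mul_le_mul_of_nonneg_left ?_ hc.le
  have hsi : 0 < s⁻¹ := inv_pos.2 hs
  have hA0 : 0 ≤ 2 * s⁻¹ * (X - 1 + l ^ 2 / 2 * s ^ 2) :=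
    mul_nonneg (by positivity) (by linarith)
  have hA1 : 2 * s⁻¹ * (X - 1 + l ^ 2 / 2 * s ^ 2) ≤ l ^ 4 / 2 * s ^ 3 := by
    have h := mul_le_mul_of_nonneg_left
      (show X - 1 + l ^ 2 / 2 * s ^ 2 ≤ (l ^ 2 / 2 * s ^ 2) ^ 2 by linarith)
      (show 0 ≤ 2 * s⁻¹ by positivity)
    refine h.trans (le_of_eq ?_)
    field_simp
  have hB0 : 0 ≤ l ^ 2 * (2 * s - J) := mul_nonneg (by positivity) (by linarith)
  have hB1 : l ^ 2 * (2 * s - J) ≤ l ^ 4 / 3 * s ^ 3 := by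
    have h := mul_le_mul_of_nonneg_left
      (show 2 * s - J ≤ l ^ 2 / 2 * (2 / 3 * s ^ 3) by linarith) (sq_nonneg l)
    refine h.trans (le_of_eq ?_)
    ring
  have hP : 0 ≤ l ^ 4 * s ^ 3 := by positivity
  rw [abs_le]
  constructor <;> linarith
end

section
/- Fix λ ∈ ℝ, and define q(μ) := 0 for μ ≤ 1 and q(μ) := the unique solution in (0,1) of 1 − q = e^{-μ q} for μ > 1. Then n^{1/3} · q(1 + λ n^{-1/3}) → 2·max(λ, 0) as n → ∞ (n ranging over positive integers). -/
open Filter Real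

theorem q_bounds (e x : ℝ) (he : 0 < e) (hx0 : 0 < x) (hx1 : x < 1)
    (h : 1 - x = Real.exp (-(1 + e) * x)) :
    x ≤ 2 * e ∧ (e ≤ 1/4 → 2 * e - 16 * e ^ 2 ≤ x) := by
  have hl : Real.log (1 - x) = -(1 + e) * x := by rw [h, Real.log_exp]
  have habs : |x| < 1 := by rw [abs_of_pos hx0]; exact hx1
  have h1 := Real.hasSum_pow_div_log_of_abs_lt_one habs
  have h2 := sum_le_hasSum (Finset.range 2) (fun i _ => by positivity) h1
  have h3 := Real.abs_log_sub_add_sum_range_le habs 2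
  simp only [Finset.sum_range_succ, Finset.sum_range_zero, hl] at h2 h3
  rw [abs_of_pos hx0] at h3
  norm_num at h2 h3
  have hxe : x ≤ 2 * e := by
    by_contra hc
    push Not at hc
    nlinarith
  refine ⟨hxe, fun he4 => ?_⟩
  have h4 : x ^ 3 / (1 - x) ≤ 2 * x ^ 3 := by
    rw [div_le_iff₀ (by linarith)]
    nlinarith [pow_pos hx0 3]
  have h5 := (abs_le.1 (h3.trans h4)).1
  have h6 : x * (e - x / 2 - 2 * x ^ 2) ≤ 0 := by nlinarith
  have h7 : e - x / 2 - 2 * x ^ 2 ≤ 0 := by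
    by_contra hc
    push Not at hc
    nlinarith [mul_pos hx0 hc]
  nlinarith

theorem stmt_4 (l : ℝ) (q : ℝ → ℝ)
    (hq0 : ∀ μ : ℝ, μ ≤ 1 → q μ = 0)
    (hq1 : ∀ μ : ℝ, 1 < μ → q μ ∈ Set.Ioo (0 : ℝ) 1 ∧ 1 - q μ = Real.exp (-μ * q μ)) :
    Tendsto (fun n : ℕ => (n : ℝ) ^ ((1:ℝ)/3) * q (1 + l * (n : ℝ) ^ (-(1:ℝ)/3)))
      atTop (nhds (2 * max l 0)) := by
  rcases le_or_gt l 0 with hl | hl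
  · rw [max_eq_right hl]
    have : ∀ n : ℕ, (n : ℝ) ^ ((1:ℝ)/3) * q (1 + l * (n : ℝ) ^ (-(1:ℝ)/3)) = 0 := by
      intro n
      have h0 : (0:ℝ) ≤ (n : ℝ) ^ (-(1:ℝ)/3) := by positivity
      rw [hq0 _ (by nlinarith), mul_zero]
    simp only [this, mul_zero]
    exact tendsto_const_nhds
  · rw [max_eq_left hl.le]
    have ht : Tendsto (fun n : ℕ => (n : ℝ) ^ ((1:ℝ)/3)) atTop atTop :=
      (tendsto_rpow_atTop (by norm_num)).comp tendsto_natCast_atTop_atTop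
    have hb : ∀ᶠ n : ℕ in atTop,
        (2 * l - 16 * l ^ 2 * ((n : ℝ) ^ ((1:ℝ)/3))⁻¹ ≤
          (n : ℝ) ^ ((1:ℝ)/3) * q (1 + l * (n : ℝ) ^ (-(1:ℝ)/3))) ∧
        (n : ℝ) ^ ((1:ℝ)/3) * q (1 + l * (n : ℝ) ^ (-(1:ℝ)/3)) ≤ 2 * l := by
      filter_upwards [ht.eventually_ge_atTop (4 * l)] with n hn
      have e1 : (n : ℝ) ^ (-(1:ℝ)/3) = ((n : ℝ) ^ ((1:ℝ)/3))⁻¹ := by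
        rw [← Real.rpow_neg (Nat.cast_nonneg n)]; norm_num
      rw [e1]
      generalize (n : ℝ) ^ ((1:ℝ)/3) = t at *
      have htp : 0 < t := by linarith
      have hep : 0 < l * t⁻¹ := by positivity
      obtain ⟨⟨a, b⟩, c⟩ := hq1 (1 + l * t⁻¹) (by linarith)
      obtain ⟨h1, h2⟩ := q_bounds _ _ hep a b c
      have h3 := h2 (by rw [← div_eq_mul_inv, div_le_iff₀ htp]; linarith)
      have h1' := mul_le_mul_of_nonneg_left h1 htp.le
      have h3' := mul_le_mul_of_nonneg_left h3 htp.le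
      constructor
      · refine le_trans (le_of_eq ?_) h3'
        field_simp
      · refine h1'.trans (le_of_eq ?_)
        field_simp
    refine tendsto_of_tendsto_of_tendsto_of_le_of_le' ?_ tendsto_const_nhds
      (hb.mono fun n h => h.1) (hb.mono fun n h => h.2)
    have := (ht.inv_tendsto_atTop.const_mul (16 * l ^ 2)).const_sub (2 * l)
    simpa using this
end

section
/- Fix λ ∈ ℝ, let x > 0, and let (k_n) be a sequence of positive integers with k_n · n^{-2/3} → x as n → ∞. Then n · b_{k_n}(1 + λ n^{-1/3}) → (2π)^{-1/2} x^{-3/2} e^{-λ² x / 2} as n → ∞, where b_k(μ) := k^{k−1} μ^{k−1} e^{-kμ} / k! for positive integers k and real μ > 0. -/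
open Filter Real

/-- The Borel(μ) probability mass function: the probability that a Galton–Watson
process with Poisson(μ) offspring has total progeny exactly `k`. -/
noncomputable def borelPMF (k : ℕ) (μ : ℝ) : ℝ :=
  (k : ℝ) ^ (k - 1) * μ ^ (k - 1) * Real.exp (-(k : ℝ) * μ) / (Nat.factorial k)

theorem aux_identity (k : ℕ) (hk : 0 < k) (N t m : ℝ) (ht : 0 < t) (hN : N * t ^ 3 = 1)
    (hm : 0 < 1 + m) :
    N * borelPMF k (1 + m) =
      (√2 * (k * t ^ 2 * √(k * t ^ 2)) * Stirling.stirlingSeq k * (1 + m))⁻¹ *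
        Real.exp (k * (Real.log (1 + m) - m)) := by
  have hk' : (0:ℝ) < k := by exact_mod_cast hk
  have hN' : N = 1 / t ^ 3 := by field_simp; exact hN
  have hs : √((k:ℝ) * t ^ 2) = √k * t := by
    rw [Real.sqrt_mul hk'.le, Real.sqrt_sq ht.le]
  have hf : (0:ℝ) < Nat.factorial k := by positivity
  have h2 : √(2 * (k:ℝ)) = √2 * √k := Real.sqrt_mul (by norm_num) _
  have he : Real.exp (k * (Real.log (1 + m) - m)) =
      (1 + m) ^ k * Real.exp 1 ^ k * Real.exp (-(k:ℝ) * (1 + m)) := by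
    rw [← Real.exp_nat_mul, ← Real.exp_log (pow_pos hm k), Real.log_pow, ← Real.exp_add,
      ← Real.exp_add]
    congr 1; ring
  have hE := Real.exp_pos 1
  have hsk : 0 < √(k:ℝ) := Real.sqrt_pos.2 hk'
  have hs2 : 0 < √(2:ℝ) := by positivity
  rw [he, hs, hN']
  unfold borelPMF Stirling.stirlingSeq
  rw [h2]
  obtain ⟨j, rfl⟩ : ∃ j, k = j + 1 := ⟨k - 1, by omega⟩
  rw [Nat.add_sub_cancel, div_pow]
  generalize ((j + 1 : ℕ) : ℝ) = a at *
  field_simp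
  ring

theorem stmt_5 (l x : ℝ) (hx : 0 < x) (k : ℕ → ℕ) (hk : ∀ n, 0 < k n)
    (hkx : Tendsto (fun n : ℕ => (k n : ℝ) * (n : ℝ) ^ (-(2:ℝ)/3)) atTop (nhds x)) :
    Tendsto (fun n : ℕ => (n : ℝ) * borelPMF (k n) (1 + l * (n : ℝ) ^ (-(1:ℝ)/3)))
      atTop
      (nhds ((2 * π) ^ (-(1/2 : ℝ)) * x ^ (-(3/2 : ℝ)) * Real.exp (-(l ^ 2) * x / 2))) := by
  set t : ℕ → ℝ := fun n => (n : ℝ) ^ (-(1:ℝ)/3) with ht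
  have ht0 : Tendsto t atTop (nhds 0) := by
    have := (tendsto_rpow_neg_atTop (y := 1/3) (by norm_num)).comp
      (tendsto_natCast_atTop_atTop (R := ℝ))
    refine this.congr fun n => ?_
    simp only [Function.comp, ht]; congr 1; norm_num
  have htpos : ∀ n, 0 < n → 0 < t n := fun n hn => by
    have : (0:ℝ) < n := by exact_mod_cast hn
    simp only [ht]; positivity
  have ht2 : ∀ n : ℕ, (n : ℝ) ^ (-(2:ℝ)/3) = t n ^ 2 := fun n => by
    simp only [ht]
    rw [← Real.rpow_natCast, ← Real.rpow_mul (Nat.cast_nonneg n)]; norm_num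
  have ht3 : ∀ n : ℕ, 0 < n → (n:ℝ) * t n ^ 3 = 1 := fun n hn => by
    have : (0:ℝ) < n := by exact_mod_cast hn
    simp only [ht]
    rw [← Real.rpow_natCast, ← Real.rpow_mul (Nat.cast_nonneg n)]
    norm_num [Real.rpow_neg_one]
    field_simp
  simp only [ht2] at hkx
  have hlt : Tendsto (fun n => l * t n) atTop (nhds 0) := by simpa using ht0.const_mul l
  have hsmall : ∀ᶠ n in atTop, |l * t n| < 1 := by
    have := hlt.abs
    rw [abs_zero] at this
    exact this.eventually_lt_const one_pos
  have hkinf : Tendsto k atTop atTop := by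
    rw [← tendsto_natCast_atTop_iff (R := ℝ)]
    have h1 : Tendsto (fun n => (t n ^ 2)⁻¹) atTop atTop := by
      apply Tendsto.inv_tendsto_nhdsGT_zero
      rw [tendsto_nhdsWithin_iff]
      refine ⟨by simpa using ht0.pow 2, ?_⟩
      filter_upwards [eventually_gt_atTop 0] with n hn
      exact pow_pos (htpos n hn) 2
    refine (hkx.pos_mul_atTop hx h1).congr' ?_
    filter_upwards [eventually_gt_atTop 0] with n hn
    have := htpos n hn
    field_simp
  have hS := Stirling.tendsto_stirlingSeq_sqrt_pi.comp hkinf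
  have hexp : Tendsto (fun n => (k n : ℝ) * (Real.log (1 + l * t n) - l * t n)) atTop
      (nhds (-(l ^ 2) * x / 2)) := by
    have hA : Tendsto (fun n => (k n : ℝ) * t n ^ 2 * (-(l^2)/2)) atTop
      (nhds (x * (-(l^2)/2))) := hkx.mul_const _
    have hB : Tendsto (fun n => ((k n : ℝ) * t n ^ 2) * (l ^ 2 * |l * t n| / (1 - |l * t n|)))
        atTop (nhds 0) := by
      have h0 := hlt.abs
      rw [abs_zero] at h0
      have := hkx.mul ((h0.const_mul (l^2)).div (h0.const_sub 1) (by norm_num))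
      simpa using this
    have hC : Tendsto (fun n => (k n : ℝ) * (Real.log (1 + l * t n) - l * t n)
        - (k n : ℝ) * t n ^ 2 * (-(l^2)/2)) atTop (nhds 0) := by
      refine squeeze_zero_norm' ?_ hB
      filter_upwards [hsmall] with n hn
      have h := Real.abs_log_sub_add_sum_range_le (x := -(l * t n)) (by rwa [abs_neg]) 2
      rw [abs_neg] at h
      simp only [Finset.sum_range_succ, Finset.sum_range_zero] at h
      norm_num at h
      have h3 : |l * t n| ^ 3 = t n ^ 2 * (l ^ 2 * |l * t n|) := by
        rw [pow_succ, sq_abs]; ring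
      rw [← abs_mul, h3] at h
      rw [Real.norm_eq_abs]
      calc _ = |(k n : ℝ) * (-(l * t n) + (l * t n)^2/2 + Real.log (1 + l * t n))| := by
            congr 1; ring
        _ = (k n : ℝ) * |(-(l * t n) + (l * t n)^2/2 + Real.log (1 + l * t n))| := by
            rw [abs_mul, Nat.abs_cast]
        _ ≤ (k n : ℝ) * (t n ^ 2 * (l ^ 2 * |l * t n|) / (1 - |l * t n|)) := by
            gcongr
        _ = _ := by ring
    have := hC.add hA
    simp only [sub_add_cancel] at this
    convert this using 2
    ring
  have hmain := ((((hkx.mul hkx.sqrt).const_mul √2).mul hS).mul (hlt.const_add 1)).inv₀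
    (by have := Real.pi_pos; positivity)
  have hfin := hmain.mul ((Real.continuous_exp.tendsto _).comp hexp)
  have hval : (√2 * (x * √x) * √π * (1 + 0))⁻¹ = (2 * π) ^ (-(1/2 : ℝ)) * x ^ (-(3/2 : ℝ)) := by
    rw [Real.rpow_neg (by positivity), Real.rpow_neg hx.le, ← Real.sqrt_eq_rpow,
      Real.sqrt_mul (by norm_num), show (3/2:ℝ) = 1 + 1/2 by norm_num, Real.rpow_add hx,
      Real.rpow_one, ← Real.sqrt_eq_rpow, ← mul_inv]
    congr 1; ring
  rw [hval] at hfin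
  refine hfin.congr' ?_
  filter_upwards [hsmall, eventually_gt_atTop 0] with n hn hn0
  exact (aux_identity (k n) (hk n) n (t n) (l * t n) (htpos n hn0) (ht3 n hn0)
    (by linarith [(abs_lt.1 hn).1])).symm
end

section
/- Fix λ ∈ ℝ and ε > 0, and let b_k(μ) := k^{k−1} μ^{k−1} e^{-kμ} / k!. Then lim_{n→∞} n^{1/3} · Σ_{k ≥ ε n^{2/3}} b_k(1 + λ n^{-1/3}) = ∫_ε^∞ (2π)^{-1/2} x^{-3/2} e^{-λ² x / 2} dx, where the sum is over all integers k with k ≥ ε n^{2/3} (the series converges for every n with 1 + λ n^{-1/3} > 0). -/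
open Filter Real MeasureTheory

lemma borel_formula (k : ℕ) (hk : 1 ≤ k) (μ : ℝ) (hμ : 0 < μ) :
    borelPMF k μ = (Stirling.stirlingSeq k)⁻¹ * (√2)⁻¹ * (k : ℝ) ^ (-(3/2 : ℝ)) * μ⁻¹ *
      Real.exp (k * (Real.log μ - (μ - 1))) := by
  obtain ⟨m, rfl⟩ : ∃ m, k = m + 1 := ⟨k - 1, by omega⟩
  have hk0 : (0:ℝ) < ((m + 1 : ℕ) : ℝ) := by positivity
  unfold borelPMF Stirling.stirlingSeq
  generalize hK : ((m + 1 : ℕ) : ℝ) = K at *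
  have h1 : K ^ (-(3/2 : ℝ)) = (K * √K)⁻¹ := by
    rw [Real.rpow_neg hk0.le, show (3/2 : ℝ) = 1 + 1/2 by norm_num, Real.rpow_add hk0,
      Real.rpow_one, ← Real.sqrt_eq_rpow]
  have h2 : Real.exp (K * (Real.log μ - (μ - 1))) = μ ^ (m+1) * Real.exp 1 ^ (m+1) *
      Real.exp (-K * μ) := by
    rw [← Real.exp_nat_mul, hK, ← Real.rpow_natCast μ, hK, Real.rpow_def_of_pos hμ,
      ← Real.exp_add, ← Real.exp_add]
    congr 1; ring
  rw [h1, h2, Real.sqrt_mul (by norm_num), div_pow]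
  have hs : √K ≠ 0 := (Real.sqrt_pos.2 hk0).ne'
  have hs2 : √(2:ℝ) ≠ 0 := by positivity
  have hf : ((Nat.factorial (m+1) : ℕ) : ℝ) ≠ 0 := by positivity
  have hss : √K ^ 2 = K := Real.sq_sqrt hk0.le
  simp only [Nat.add_sub_cancel]
  field_simp
  ring

lemma integral_floor (g : ℕ → ℝ) (hg : IntegrableOn (fun t : ℝ => g ⌊t⌋₊) (Set.Ioi 0)) :
    ∑' k, g k = ∫ t in Set.Ioi (0:ℝ), g ⌊t⌋₊ := by
  have hU : (⋃ k : ℕ, Set.Ico (k:ℝ) (k+1)) = Set.Ici 0 := by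
    ext t
    simp only [Set.mem_iUnion, Set.mem_Ico, Set.mem_Ici]
    constructor
    · rintro ⟨k, h, -⟩; exact le_trans (Nat.cast_nonneg k) h
    · intro h; exact ⟨⌊t⌋₊, Nat.floor_le h, Nat.lt_floor_add_one t⟩
  have hd : Pairwise (Function.onFun Disjoint fun k : ℕ => Set.Ico (k:ℝ) (k+1)) := by
    intro i j hij
    rw [Function.onFun, Set.disjoint_left]
    rintro t ⟨h1, h2⟩ ⟨h3, h4⟩
    have a : (i:ℝ) < j + 1 := by linarith
    have b : (j:ℝ) < i + 1 := by linarith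
    norm_cast at a b
    omega
  have h := hasSum_integral_iUnion (μ := volume) (f := fun t : ℝ => g ⌊t⌋₊)
    (s := fun k : ℕ => Set.Ico (k:ℝ) (k+1)) (fun i => measurableSet_Ico) hd
    (by rw [hU, integrableOn_Ici_iff_integrableOn_Ioi]; exact hg)
  rw [hU, integral_Ici_eq_integral_Ioi] at h
  rw [← h.tsum_eq]
  congr 1; ext k
  rw [setIntegral_congr_fun (g := fun _ => g k) measurableSet_Ico]
  · simp
  · rintro t ⟨h1, h2⟩
    have : ⌊t⌋₊ = k := (Nat.floor_eq_iff (le_trans (Nat.cast_nonneg k) h1)).2 ⟨h1, h2⟩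
    simp [this]

/-- scaled step function -/
noncomputable def stepF (l ε : ℝ) (n : ℕ) (x : ℝ) : ℝ :=
  (n:ℝ) * (if ε * (n : ℝ) ^ ((2:ℝ)/3) ≤ ((⌊(n : ℝ) ^ ((2:ℝ)/3) * x⌋₊ : ℕ) : ℝ) then
    borelPMF ⌊(n : ℝ) ^ ((2:ℝ)/3) * x⌋₊ (1 + l * (n : ℝ) ^ (-(1:ℝ)/3)) else 0)

lemma sum_eq (l ε : ℝ) (n : ℕ) (hn : 1 ≤ n) (hi : IntegrableOn (stepF l ε n) (Set.Ioi 0)) :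
    (n : ℝ) ^ ((1:ℝ)/3) *
        ∑' k : ℕ, (if ε * (n : ℝ) ^ ((2:ℝ)/3) ≤ (k : ℝ) then
          borelPMF k (1 + l * (n : ℝ) ^ (-(1:ℝ)/3)) else 0)
      = ∫ x in Set.Ioi 0, stepF l ε n x := by
  have hn0 : (0:ℝ) < n := by exact_mod_cast hn
  set N := (n : ℝ) ^ ((2:ℝ)/3) with hN
  have hN0 : 0 < N := by positivity
  set g : ℕ → ℝ := fun k => if ε * N ≤ (k : ℝ) then
          borelPMF k (1 + l * (n : ℝ) ^ (-(1:ℝ)/3)) else 0 with hgdef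
  have hF : stepF l ε n = fun x => (n:ℝ) * (fun t : ℝ => g ⌊t⌋₊) (N * x) := rfl
  have hg : IntegrableOn (fun t : ℝ => g ⌊t⌋₊) (Set.Ioi 0) := by
    have := (integrableOn_Ioi_comp_mul_left_iff (fun t : ℝ => g ⌊t⌋₊) 0 hN0)
    rw [mul_zero] at this
    rw [← this]
    rw [hF] at hi
    have h2 : IntegrableOn _ (Set.Ioi (0:ℝ)) volume := Integrable.const_mul hi (n:ℝ)⁻¹
    refine h2.congr_fun (fun x _ => ?_) measurableSet_Ioi
    simp only
    field_simp
  rw [integral_floor g hg, hF, integral_const_mul, integral_comp_mul_left_Ioi (fun t : ℝ => g ⌊t⌋₊) 0 hN0, mul_zero,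
    smul_eq_mul, ← mul_assoc]
  congr 1
  rw [hN, ← Real.rpow_neg hn0.le]
  nth_rewrite 2 [← Real.rpow_one (n:ℝ)]
  rw [← Real.rpow_add hn0]
  norm_num

lemma scale_eq (n : ℕ) (hn : 1 ≤ n) (k : ℝ) (hk : 0 < k) :
    (n:ℝ) * k ^ (-(3/2 : ℝ)) = (k / (n : ℝ) ^ ((2:ℝ)/3)) ^ (-(3/2 : ℝ)) := by
  have hn0 : (0:ℝ) < n := by exact_mod_cast hn
  rw [Real.div_rpow hk.le (by positivity), ← Real.rpow_mul hn0.le]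
  norm_num
  rw [Real.rpow_neg_one]
  field_simp

lemma tendsto_u (l : ℝ) : Tendsto (fun n : ℕ => l * (n : ℝ) ^ (-(1:ℝ)/3)) atTop (nhds 0) := by
  have h := (tendsto_rpow_neg_atTop (show (0:ℝ) < 1/3 by norm_num)).comp
    (tendsto_natCast_atTop_atTop (R := ℝ))
  have h2 := h.const_mul l
  rw [mul_zero] at h2
  refine h2.congr (fun n => ?_)
  simp only [Function.comp]
  norm_num

lemma tendsto_N : Tendsto (fun n : ℕ => (n : ℝ) ^ ((2:ℝ)/3)) atTop atTop :=
  (tendsto_rpow_atTop (show (0:ℝ) < 2/3 by norm_num)).comp tendsto_natCast_atTop_atTop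

lemma sq_eq (n : ℕ) : ((n : ℝ) ^ (-(1:ℝ)/3)) ^ 2 = ((n : ℝ) ^ ((2:ℝ)/3))⁻¹ := by
  rw [← Real.rpow_neg (Nat.cast_nonneg n), ← Real.rpow_natCast, ← Real.rpow_mul (Nat.cast_nonneg n)]
  norm_num

lemma log_bound (u : ℝ) (hu : |u| ≤ 1/2) :
    |Real.log (1 + u) - u + u ^ 2 / 2| ≤ 2 * |u| ^ 3 := by
  have h := Real.abs_log_sub_add_sum_range_le (x := -u) (by rw [abs_neg]; linarith) 2
  simp only [Finset.sum_range_succ, Finset.sum_range_zero, abs_neg] at h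
  norm_num at h
  have e : Real.log (1 + u) - u + u ^ 2 / 2 = -u + u ^ 2 / 2 + Real.log (1 + u) := by ring
  rw [e]
  refine h.trans ?_
  rw [div_le_iff₀ (by linarith)]
  nlinarith [pow_nonneg (abs_nonneg u) 3]

lemma pointwise (l ε x : ℝ) (hε : 0 < ε) (hx : ε < x) :
    Tendsto (fun n => stepF l ε n x) atTop (nhds
      ((2 * π) ^ (-(1/2 : ℝ)) * x ^ (-(3/2 : ℝ)) * Real.exp (-(l ^ 2) * x / 2))) := by
  have hx0 : 0 < x := hε.trans hx
  have hfl : Tendsto (fun n : ℕ => ((⌊(n : ℝ) ^ ((2:ℝ)/3) * x⌋₊ : ℕ) : ℝ) / (n : ℝ) ^ ((2:ℝ)/3))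
      atTop (nhds x) := by
    have := (tendsto_nat_floor_mul_div_atTop hx0.le).comp tendsto_N
    refine this.congr (fun n => ?_)
    simp only [Function.comp, mul_comm]
  have hk : Tendsto (fun n : ℕ => ⌊(n : ℝ) ^ ((2:ℝ)/3) * x⌋₊) atTop atTop :=
    tendsto_nat_floor_atTop.comp (tendsto_N.atTop_mul_const hx0)
  have hst := Stirling.tendsto_stirlingSeq_sqrt_pi.comp hk
  have hu := tendsto_u l
  -- exponent
  have hexp : Tendsto (fun n : ℕ => ((⌊(n : ℝ) ^ ((2:ℝ)/3) * x⌋₊ : ℕ) : ℝ) *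
      (Real.log (1 + l * (n : ℝ) ^ (-(1:ℝ)/3)) - (1 + l * (n : ℝ) ^ (-(1:ℝ)/3) - 1)))
      atTop (nhds (-(l ^ 2) * x / 2)) := by
    have hz : Tendsto (fun n : ℕ => ((⌊(n : ℝ) ^ ((2:ℝ)/3) * x⌋₊ : ℕ) : ℝ) *
      (Real.log (1 + l * (n : ℝ) ^ (-(1:ℝ)/3)) - l * (n : ℝ) ^ (-(1:ℝ)/3) +
        (l * (n : ℝ) ^ (-(1:ℝ)/3))^2/2)) atTop (nhds 0) := by
      have hb : Tendsto (fun n : ℕ => 2 * l^2 * (((⌊(n : ℝ) ^ ((2:ℝ)/3) * x⌋₊ : ℕ) : ℝ) /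
          (n : ℝ) ^ ((2:ℝ)/3)) * |l * (n : ℝ) ^ (-(1:ℝ)/3)|) atTop (nhds 0) := by
        have := (hfl.const_mul (2 * l^2)).mul hu.abs
        simpa using this
      refine squeeze_zero_norm' ?_ hb
      have hu2 : ∀ᶠ n : ℕ in atTop, |l * (n : ℝ) ^ (-(1:ℝ)/3)| < 1/2 := by
        have := hu.abs
        rw [abs_zero] at this
        exact this.eventually_lt_const (by norm_num)
      filter_upwards [hu2, eventually_ge_atTop 1] with n hn hn1
      have hn0 : (0:ℝ) < n := by exact_mod_cast hn1
      rw [norm_mul, Real.norm_natCast, Real.norm_eq_abs]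
      refine (mul_le_mul_of_nonneg_left (log_bound _ hn.le) (Nat.cast_nonneg _)).trans (le_of_eq ?_)
      rw [pow_succ, sq_abs, mul_pow, sq_eq, div_eq_mul_inv]
      ring
    have hm : Tendsto (fun n : ℕ => -(l^2/2) * (((⌊(n : ℝ) ^ ((2:ℝ)/3) * x⌋₊ : ℕ) : ℝ) /
          (n : ℝ) ^ ((2:ℝ)/3))) atTop (nhds (-(l^2/2) * x)) := hfl.const_mul _
    have := hz.add hm
    rw [show 0 + -(l^2/2) * x = -(l ^ 2) * x / 2 by ring] at this
    refine this.congr' ?_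
    filter_upwards [eventually_ge_atTop 1] with n hn1
    have hn0 : (0:ℝ) < n := by exact_mod_cast hn1
    rw [mul_pow, sq_eq, div_eq_mul_inv]
    ring
  have hrp : Tendsto (fun n : ℕ => (((⌊(n : ℝ) ^ ((2:ℝ)/3) * x⌋₊ : ℕ) : ℝ) /
      (n : ℝ) ^ ((2:ℝ)/3)) ^ (-(3/2 : ℝ))) atTop (nhds (x ^ (-(3/2 : ℝ)))) :=
    hfl.rpow_const (Or.inl hx0.ne')
  have hmu : Tendsto (fun n : ℕ => (1 + l * (n : ℝ) ^ (-(1:ℝ)/3))⁻¹) atTop (nhds 1) := by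
    have := (hu.const_add 1).inv₀ (by norm_num)
    simpa using this
  have hpi : √π ≠ 0 := (Real.sqrt_pos.2 Real.pi_pos).ne'
  have hall := ((((hst.inv₀ hpi).mul_const (√2)⁻¹).mul hrp).mul hmu).mul
    ((Real.continuous_exp.tendsto _).comp hexp)
  have hval : (√π)⁻¹ * (√2)⁻¹ * x ^ (-(3/2 : ℝ)) * 1 * Real.exp (-(l ^ 2) * x / 2) =
    (2 * π) ^ (-(1/2 : ℝ)) * x ^ (-(3/2 : ℝ)) * Real.exp (-(l ^ 2) * x / 2) := by
    rw [Real.rpow_neg (x := 2 * π) (by positivity), ← Real.sqrt_eq_rpow, Real.sqrt_mul (by norm_num), mul_inv]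
    ring
  rw [hval] at hall
  refine hall.congr' ?_
  have hmupos : ∀ᶠ n : ℕ in atTop, 0 < 1 + l * (n : ℝ) ^ (-(1:ℝ)/3) := by
    have := hu.const_add 1
    exact this.eventually_const_lt (by norm_num)
  filter_upwards [hmupos, eventually_ge_atTop 1, hk.eventually_ge_atTop 1,
    hfl.eventually_const_lt hx] with n h1 h2 h3 h4
  have hn0 : (0:ℝ) < n := by exact_mod_cast h2
  have hk0 : (0:ℝ) < ((⌊(n : ℝ) ^ ((2:ℝ)/3) * x⌋₊ : ℕ) : ℝ) := by exact_mod_cast h3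
  rw [lt_div_iff₀ (by positivity)] at h4
  unfold stepF
  rw [if_pos h4.le, borel_formula _ h3 _ h1, ← scale_eq n h2 _ hk0]
  simp only [Function.comp]
  ring

lemma bound_F (l ε : ℝ) (hε : 0 < ε) : ∃ C : ℝ, ∀ᶠ n : ℕ in atTop, ∀ x ∈ Set.Ioi (0:ℝ),
    ‖stepF l ε n x‖ ≤ (Set.Ici ε).indicator (fun x => C * x ^ (-(3/2 : ℝ))) x := by
  obtain ⟨a, ha, hst⟩ := Stirling.stirlingSeq'_bounded_by_pos_constant
  refine ⟨a⁻¹ * (√2)⁻¹ * (1/2) ^ (-(3/2 : ℝ)) * 2, ?_⟩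
  have hmupos : ∀ᶠ n : ℕ in atTop, 1/2 < 1 + l * (n : ℝ) ^ (-(1:ℝ)/3) := by
    have := (tendsto_u l).const_add 1
    exact this.eventually_const_lt (by norm_num)
  filter_upwards [hmupos, eventually_ge_atTop 1] with n h1 h2 x hx
  have hx0 : 0 < x := hx
  have hn0 : (0:ℝ) < n := by exact_mod_cast h2
  have hN0 : (0:ℝ) < (n : ℝ) ^ ((2:ℝ)/3) := by positivity
  have hnn : 0 ≤ (Set.Ici ε).indicator
      (fun x => a⁻¹ * (√2)⁻¹ * (1/2) ^ (-(3/2 : ℝ)) * 2 * x ^ (-(3/2 : ℝ))) x := by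
    by_cases h : x ∈ Set.Ici ε
    · rw [Set.indicator_of_mem h]; positivity
    · rw [Set.indicator_of_notMem h]
  unfold stepF
  split_ifs with hif
  swap
  · simpa using hnn
  have hfle : ((⌊(n : ℝ) ^ ((2:ℝ)/3) * x⌋₊ : ℕ) : ℝ) ≤ (n : ℝ) ^ ((2:ℝ)/3) * x :=
    Nat.floor_le (by positivity)
  have hflt : (n : ℝ) ^ ((2:ℝ)/3) * x < ((⌊(n : ℝ) ^ ((2:ℝ)/3) * x⌋₊ : ℕ) : ℝ) + 1 :=
    Nat.lt_floor_add_one _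
  have hxε : ε ≤ x := by
    have := hif.trans hfle
    rw [mul_comm] at this
    exact le_of_mul_le_mul_left this hN0
  rw [Set.indicator_of_mem (Set.mem_Ici.2 hxε)]
  have hk0 : (0:ℝ) < ((⌊(n : ℝ) ^ ((2:ℝ)/3) * x⌋₊ : ℕ) : ℝ) := lt_of_lt_of_le (by positivity) hif
  generalize ⌊(n : ℝ) ^ ((2:ℝ)/3) * x⌋₊ = k at *
  have hk1 : 1 ≤ k := by exact_mod_cast hk0
  have hk1r : (1:ℝ) ≤ k := by exact_mod_cast hk1
  have hμ0 : 0 < 1 + l * (n : ℝ) ^ (-(1:ℝ)/3) := by linarith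
  generalize 1 + l * (n : ℝ) ^ (-(1:ℝ)/3) = μ at *
  have hsk : a ≤ Stirling.stirlingSeq k := by
    have := hst (k - 1)
    rwa [Nat.sub_add_cancel hk1] at this
  have hs0 := ha.trans_le hsk
  have hr : (n:ℝ) * (k:ℝ) ^ (-(3/2 : ℝ)) ≤ (1/2) ^ (-(3/2 : ℝ)) * x ^ (-(3/2 : ℝ)) := by
    rw [scale_eq n h2 _ hk0, ← Real.mul_rpow (by norm_num) hx0.le]
    apply Real.rpow_le_rpow_of_nonpos (by positivity) _ (by norm_num)
    rw [le_div_iff₀ hN0]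
    nlinarith
  have he : Real.exp (k * (Real.log μ - (μ - 1))) ≤ 1 := by
    rw [Real.exp_le_one_iff]
    exact mul_nonpos_of_nonneg_of_nonpos hk0.le (by linarith [Real.log_le_sub_one_of_pos hμ0])
  have hmi : μ⁻¹ ≤ 2 := by
    rw [inv_le_comm₀ hμ0 (by norm_num)]; linarith
  rw [borel_formula k hk1 μ hμ0, Real.norm_of_nonneg (by positivity)]
  calc _ = (Stirling.stirlingSeq k)⁻¹ * (√2)⁻¹ * ((n:ℝ) * (k:ℝ) ^ (-(3/2 : ℝ))) * μ⁻¹ *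
      Real.exp (k * (Real.log μ - (μ - 1))) := by ring
    _ ≤ a⁻¹ * (√2)⁻¹ * ((1/2) ^ (-(3/2 : ℝ)) * x ^ (-(3/2 : ℝ))) * 2 * 1 := by
      gcongr
    _ = _ := by ring

lemma meas_F (l ε : ℝ) (n : ℕ) : Measurable (stepF l ε n) := by
  have : stepF l ε n = (fun k : ℕ => (n:ℝ) * (if ε * (n : ℝ) ^ ((2:ℝ)/3) ≤ (k : ℝ) then
    borelPMF k (1 + l * (n : ℝ) ^ (-(1:ℝ)/3)) else 0)) ∘
      (fun x : ℝ => ⌊(n : ℝ) ^ ((2:ℝ)/3) * x⌋₊) := rfl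
  rw [this]
  exact (measurable_of_countable _).comp (Nat.measurable_floor.comp (measurable_const_mul _))

theorem stmt_6 (l ε : ℝ) (hε : 0 < ε) :
    Tendsto
      (fun n : ℕ => (n : ℝ) ^ ((1:ℝ)/3) *
        ∑' k : ℕ, if ε * (n : ℝ) ^ ((2:ℝ)/3) ≤ (k : ℝ) then
          borelPMF k (1 + l * (n : ℝ) ^ (-(1:ℝ)/3)) else 0)
      atTop
      (nhds (∫ x in Set.Ioi ε,
        (2 * π) ^ (-(1/2 : ℝ)) * x ^ (-(3/2 : ℝ)) * Real.exp (-(l ^ 2) * x / 2))) := by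
  obtain ⟨C, hC⟩ := bound_F l ε hε
  have hbi : Integrable ((Set.Ici ε).indicator (fun x : ℝ => C * x ^ (-(3/2 : ℝ))))
      (volume.restrict (Set.Ioi 0)) := by
    apply Integrable.restrict
    rw [integrable_indicator_iff measurableSet_Ici, integrableOn_Ici_iff_integrableOn_Ioi]
    exact (integrableOn_Ioi_rpow_of_lt (by norm_num) hε).const_mul C
  have hlim : (∫ x in Set.Ioi ε,
        (2 * π) ^ (-(1/2 : ℝ)) * x ^ (-(3/2 : ℝ)) * Real.exp (-(l ^ 2) * x / 2)) =
      ∫ x in Set.Ioi 0, (Set.Ioi ε).indicator (fun x =>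
        (2 * π) ^ (-(1/2 : ℝ)) * x ^ (-(3/2 : ℝ)) * Real.exp (-(l ^ 2) * x / 2)) x := by
    rw [setIntegral_indicator measurableSet_Ioi, Set.inter_eq_right.2 (Set.Ioi_subset_Ioi hε.le)]
  rw [hlim]
  have hCae : ∀ᶠ n : ℕ in atTop, ∀ᵐ x ∂(volume.restrict (Set.Ioi (0:ℝ))),
      ‖stepF l ε n x‖ ≤ (Set.Ici ε).indicator (fun x => C * x ^ (-(3/2 : ℝ))) x := by
    filter_upwards [hC] with n hn
    exact (ae_restrict_iff' measurableSet_Ioi).2 (ae_of_all _ hn)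
  have hT := tendsto_integral_filter_of_dominated_convergence (l := atTop)
    (μ := volume.restrict (Set.Ioi 0)) (F := fun n x => stepF l ε n x)
    (f := (Set.Ioi ε).indicator (fun x =>
        (2 * π) ^ (-(1/2 : ℝ)) * x ^ (-(3/2 : ℝ)) * Real.exp (-(l ^ 2) * x / 2)))
    _ (Eventually.of_forall fun n => (meas_F l ε n).aestronglyMeasurable) hCae hbi (by
      have hne : ∀ᵐ x ∂(volume.restrict (Set.Ioi (0:ℝ))), x ≠ ε :=
        ae_restrict_of_ae (Measure.ae_ne volume ε)
      filter_upwards [hne, ae_restrict_mem measurableSet_Ioi] with x hx hx0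
      rcases lt_or_gt_of_ne hx with h | h
      · rw [Set.indicator_of_notMem (by simpa using h.le)]
        refine tendsto_const_nhds.congr' ?_
        filter_upwards [hC] with n hn
        have := hn x hx0
        rw [Set.indicator_of_notMem (by simpa using h)] at this
        exact (norm_le_zero_iff.1 this).symm
      · rw [Set.indicator_of_mem (by simpa using h)]
        exact pointwise l ε x hε h)
  refine hT.congr' ?_
  filter_upwards [hCae, eventually_ge_atTop 1] with n hn h1
  exact (sum_eq l ε n h1 (hbi.mono' (meas_F l ε n).aestronglyMeasurable hn)).symm
end

section
/- There is a constant C such that for every positive integer m, | Σ_{k > m} k^{k−1} e^{-k} / k! − (2/π)^{1/2} m^{-1/2} | ≤ C m^{-3/2}, where the sum is over all integers k > m. -/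
open Real

lemma aux_stir_le (n : ℕ) : Stirling.stirlingSeq (n+1) * (1 - 1 / (12 * ((n:ℝ)+1))) ≤ √π := by
  have hmono : Monotone (fun n : ℕ => Real.log (Stirling.stirlingSeq (n+1)) - 1 / (12 * ((n:ℝ)+1))) := by
    refine monotone_nat_of_le_succ fun k => ?_
    have h := Stirling.log_stirlingSeq_sdiff_le (k+1)
    have e : (1:ℝ) / (12 * ((k+1 : ℕ):ℝ) * (((k+1:ℕ):ℝ) + 1)) = 1 / (12 * ((k:ℝ)+1)) - 1 / (12 * (((k+1:ℕ):ℝ)+1)) := by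
      push_cast
      field_simp
      ring
    rw [e] at h
    linarith
  have hlim : Filter.Tendsto (fun n : ℕ => Real.log (Stirling.stirlingSeq (n+1)) - 1 / (12 * ((n:ℝ)+1)))
      Filter.atTop (nhds (Real.log (√π) - 1/12 * 0)) := by
    refine Filter.Tendsto.sub ?_ ?_
    · have := Stirling.tendsto_stirlingSeq_sqrt_pi.comp (Filter.tendsto_add_atTop_nat 1)
      exact this.log (by positivity)
    · have := (tendsto_one_div_add_atTop_nhds_zero_nat (𝕜 := ℝ)).const_mul (1/12)
      refine this.congr fun n => ?_
      field_simp
  have h := hmono.ge_of_tendsto hlim n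
  have hs := Stirling.stirlingSeq'_pos n
  have h2 : Stirling.stirlingSeq (n+1) * Real.exp (-(1 / (12 * ((n:ℝ)+1)))) ≤ √π := by
    rw [← Real.log_le_log_iff (by positivity) (by positivity), Real.log_mul (by positivity) (by positivity), Real.log_exp]
    simp only [mul_zero, sub_zero] at h
    linarith
  refine le_trans (mul_le_mul_of_nonneg_left ?_ hs.le) h2
  have := Real.add_one_le_exp (-(1 / (12 * ((n:ℝ)+1))))
  linarith

lemma aux_term (n : ℕ) : ((n+1 : ℕ):ℝ) ^ (n+1-1) * Real.exp (-((n+1:ℕ):ℝ)) / (Nat.factorial (n+1)) =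
    1 / (((n:ℝ)+1) * √(2*((n:ℝ)+1)) * Stirling.stirlingSeq (n+1)) := by
  unfold Stirling.stirlingSeq
  have hf : ((Nat.factorial (n+1) : ℕ):ℝ) ≠ 0 := by positivity
  have hn : ((n+1 : ℕ):ℝ) = (n:ℝ)+1 := by push_cast; ring
  have he : Real.exp (-((n+1:ℕ):ℝ)) = 1 / (Real.exp 1)^(n+1) := by
    rw [← Real.exp_nat_mul, Real.exp_neg]; simp
  rw [he, hn]
  have : √(2*((n:ℝ)+1)) ≠ 0 := by positivity
  simp only [Nat.add_sub_cancel]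
  rw [div_pow, pow_succ ((n:ℝ)+1) n]
  field_simp

lemma aux_upper (n : ℕ) (hn : 0 < n) : ((n+1 : ℕ):ℝ) ^ (n+1-1) * Real.exp (-((n+1:ℕ):ℝ)) / (Nat.factorial (n+1)) ≤
    √(2/π) * (1/√(n:ℝ) - 1/√((n:ℝ)+1)) := by
  rw [aux_term]
  have hs := Stirling.sqrt_pi_le_stirlingSeq (n := n+1) (by omega)
  have hn' : (0:ℝ) < n := by exact_mod_cast hn
  obtain ⟨x, hx⟩ : ∃ x, x = √(n:ℝ) := ⟨_, rfl⟩
  obtain ⟨y, hy⟩ : ∃ y, y = √((n:ℝ)+1) := ⟨_, rfl⟩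
  have hx0 : 0 < x := by rw [hx]; positivity
  have hy0 : 0 < y := by rw [hy]; positivity
  have hx2 : x^2 = n := by rw [hx]; exact Real.sq_sqrt (by positivity)
  have hy2 : y^2 = n+1 := by rw [hy]; exact Real.sq_sqrt (by positivity)
  have h1 : 1 / (((n:ℝ)+1) * √(2*((n:ℝ)+1)) * Stirling.stirlingSeq (n+1)) ≤
      1 / (((n:ℝ)+1) * √(2*((n:ℝ)+1)) * √π) := by
    gcongr
  refine h1.trans ?_
  rw [Real.sqrt_mul (by norm_num), Real.sqrt_div (by norm_num), ← hx, ← hy, ← hy2]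
  have hp : 0 < √π := by positivity
  have h2 : 0 < √2 := by positivity
  have h22 : √2^2 = 2 := Real.sq_sqrt (by norm_num)
  have e : 1 / (y^2 * (√2 * y) * √π) = √2 / √π * (1 / (2 * y^3)) := by
    field_simp; linarith
  rw [e]
  refine mul_le_mul_of_nonneg_left ?_ (by positivity)
  have hxy : x ≤ y := by nlinarith
  have e2 : 1/x - 1/y = 1 / (x*y*(x+y)) := by
    field_simp; nlinarith
  rw [e2]
  apply one_div_le_one_div_of_le (by positivity)
  calc x*y*(x+y) ≤ y*y*(y+y) := by gcongr
    _ = _ := by ring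

lemma aux_lower (n : ℕ) : √(2/π) * (1/√((n:ℝ)+1) - 1/√((n:ℝ)+2)) ≤ 
    ((n+1 : ℕ):ℝ) ^ (n+1-1) * Real.exp (-((n+1:ℕ):ℝ)) / (Nat.factorial (n+1)) := by
  rw [aux_term]
  have hs := aux_stir_le n
  have hs0 := Stirling.stirlingSeq'_pos n
  generalize Stirling.stirlingSeq (n+1) = s at hs hs0
  obtain ⟨k, hk⟩ : ∃ k, k = (n:ℝ)+1 := ⟨_, rfl⟩
  have hk1 : 1 ≤ k := by rw [hk]; simp
  rw [show (n:ℝ)+2 = k+1 by rw [hk]; ring, ← hk]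
  rw [← hk] at hs
  obtain ⟨x, hx⟩ : ∃ x, x = √k := ⟨_, rfl⟩
  obtain ⟨y, hy⟩ : ∃ y, y = √(k+1) := ⟨_, rfl⟩
  have hx0 : 0 < x := by rw [hx]; positivity
  have hy0 : 0 < y := by rw [hy]; positivity
  have hx2 : x^2 = k := by rw [hx]; exact Real.sq_sqrt (by positivity)
  have hy2 : y^2 = k+1 := by rw [hy]; exact Real.sq_sqrt (by positivity)
  have hp : 0 < √π := by positivity
  have h2 : 0 < √2 := by positivity
  have h22 : √2^2 = 2 := Real.sq_sqrt (by norm_num)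
  rw [Real.sqrt_mul (by norm_num), Real.sqrt_div (by norm_num), ← hx, ← hy]
  have h1 : (1 - 1/(12*k)) / √π ≤ 1 / s := by
    rw [div_le_div_iff₀ hp hs0]; linarith
  have hxy : k + 1/3 ≤ x*y := by
    apply le_of_sq_le_sq _ (by positivity)
    rw [mul_pow, hx2, hy2]; nlinarith
  have e2 : 1/x - 1/y = 1 / (x*(x*y+y^2)) := by
    field_simp; nlinarith
  have h3 : 1/x - 1/y ≤ (1 - 1/(12*k)) / (2*k*x) := by
    rw [e2, hy2]
    calc 1 / (x*(x*y+(k+1))) ≤ 1/(x*(k+1/3+(k+1))) := by gcongr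
      _ ≤ _ := by
        rw [div_le_div_iff₀ (by positivity) (by positivity)]
        have : (1 - 1/(12*k)) * (x*(k+1/3+(k+1))) - 1*(2*k*x) = x * (14*k - 4/3)/(12*k) := by
          field_simp; ring
        have : 0 ≤ x * (14*k - 4/3)/(12*k) := by
          apply div_nonneg (mul_nonneg hx0.le (by linarith)) (by positivity)
        linarith
  calc √2/√π * (1/x - 1/y) ≤ √2/√π * ((1 - 1/(12*k)) / (2*k*x)) := by gcongr
    _ = (1 / (k * (√2*x))) * ((1 - 1/(12*k)) / √π) := by
      generalize (1 - 1/(12*k)) = z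
      field_simp; linear_combination z * h22
    _ ≤ (1 / (k * (√2*x))) * (1/s) := by gcongr
    _ = _ := by field_simp

lemma aux_tel (g : ℕ → ℝ) (hg : Antitone g) (h0 : Filter.Tendsto g Filter.atTop (nhds 0)) (m : ℕ) :
    HasSum (fun i => g (i+m) - g (i+m+1)) (g m) := by
  rw [hasSum_iff_tendsto_nat_of_nonneg (fun i => sub_nonneg.2 (hg (by omega)))]
  have : ∀ n, ∑ i ∈ Finset.range n, (g (i+m) - g (i+m+1)) = g m - g (n+m) := by
    intro n
    have := Finset.sum_range_sub' (fun i => g (i+m)) n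
    simp only [zero_add] at this
    rw [← this]
    refine Finset.sum_congr rfl fun i _ => ?_
    rw [show i+m+1 = i+1+m by ring]
  simp_rw [this]
  simpa using tendsto_const_nhds.sub (h0.comp (Filter.tendsto_add_atTop_nat m))

theorem stmt_8 :
    ∃ C : ℝ, ∀ m : ℕ, 0 < m →
      |(∑' k : ℕ, if m < k then (k : ℝ) ^ (k - 1) * Real.exp (-(k : ℝ)) / (Nat.factorial k) else 0) -
        (2 / π) ^ ((1/2 : ℝ)) * (m : ℝ) ^ (-(1/2 : ℝ))| ≤ C * (m : ℝ) ^ (-(3/2 : ℝ)) := by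
  refine ⟨√(2/π), fun m hm => ?_⟩
  have hm' : (0:ℝ) < m := by exact_mod_cast hm
  obtain ⟨a, ha⟩ : ∃ a : ℕ → ℝ, a = fun k : ℕ => (k : ℝ) ^ (k - 1) * Real.exp (-(k : ℝ)) / (Nat.factorial k) := ⟨_, rfl⟩
  have hlim : Filter.Tendsto (fun n : ℕ => 1/√(n:ℝ)) Filter.atTop (nhds 0) := by
    simp_rw [one_div]
    exact Filter.Tendsto.inv_tendsto_atTop (Real.tendsto_sqrt_atTop.comp tendsto_natCast_atTop_atTop)
  -- telescoping series
  have hT : ∀ p : ℕ, 0 < p → HasSum (fun i : ℕ => √(2/π) * (1/√((i+p : ℕ):ℝ) - 1/√(((i+p : ℕ):ℝ)+1))) (√(2/π) * (1/√(p:ℝ))) := by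
    intro p hp
    obtain ⟨q, rfl⟩ : ∃ q, p = q+1 := ⟨p-1, by omega⟩
    have := aux_tel (fun n : ℕ => 1/√((n+1:ℕ):ℝ)) (fun a b hab => by
      apply one_div_le_one_div_of_le
      · positivity
      · gcongr) (hlim.comp (Filter.tendsto_add_atTop_nat 1)) q
    refine HasSum.mul_left _ (this.congr_fun ?_)
    intro i
    push_cast
    ring_nf
  have hU := hT m hm
  have hL := hT (m+1) (by omega)
  have hau : ∀ i, a (i+m+1) ≤ √(2/π) * (1/√((i+m : ℕ):ℝ) - 1/√(((i+m : ℕ):ℝ)+1)) := by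
    intro i
    rw [ha]; exact aux_upper (i+m) (by omega)
  have hal : ∀ i, √(2/π) * (1/√((i+(m+1) : ℕ):ℝ) - 1/√(((i+(m+1) : ℕ):ℝ)+1)) ≤ a (i+m+1) := by
    intro i
    rw [ha]
    convert aux_lower (i+m) using 5 <;> push_cast <;> ring_nf
  have hsum : Summable (fun i => a (i+m+1)) := by
    refine Summable.of_nonneg_of_le (fun i => ?_) hau hU.summable
    rw [ha]; positivity
  have hS : (∑' k : ℕ, if m < k then (k : ℝ) ^ (k - 1) * Real.exp (-(k : ℝ)) / (Nat.factorial k) else 0) = ∑' i, a (i+m+1) := by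
    have e : (fun k : ℕ => if m < k then (k : ℝ) ^ (k - 1) * Real.exp (-(k : ℝ)) / (Nat.factorial k) else 0) = fun k => if m < k then a k else 0 := by
      rw [ha]
    rw [e]
    have e2 : ∀ i, (fun k => if m < k then a k else 0) (i+(m+1)) = a (i+m+1) := by
      intro i
      simp only [if_pos (show m < i+(m+1) by omega)]; rfl
    have hs2 : Summable (fun k => if m < k then a k else 0) := by
      rw [← summable_nat_add_iff (m+1)]
      exact hsum.congr fun i => (e2 i).symm
    rw [← hs2.sum_add_tsum_nat_add (m+1), Finset.sum_eq_zero, zero_add]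
    · exact tsum_congr e2
    · intro k hk
      rw [if_neg]; have := Finset.mem_range.1 hk; omega
  rw [hS]
  have hup := hasSum_le hau hsum.hasSum hU
  have hlo := hasSum_le hal hL hsum.hasSum
  have r1 : (m:ℝ) ^ (-(1/2:ℝ)) = 1/√(m:ℝ) := by
    rw [Real.rpow_neg hm'.le, ← Real.sqrt_eq_rpow, one_div]
  have r3 : (m:ℝ) ^ (-(3/2:ℝ)) = 1/((m:ℝ) * √(m:ℝ)) := by
    rw [show -(3/2:ℝ) = -1 + -(1/2:ℝ) by norm_num, Real.rpow_add hm', r1, Real.rpow_neg_one]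
    field_simp
  rw [← Real.sqrt_eq_rpow, r1, r3]
  have hc : 0 ≤ √(2/π) := by positivity
  have key : 1/√(m:ℝ) - 1/√((m+1:ℕ):ℝ) ≤ 1/((m:ℝ) * √(m:ℝ)) := by
    push_cast
    obtain ⟨x, hx⟩ : ∃ x, x = √(m:ℝ) := ⟨_, rfl⟩
    obtain ⟨y, hy⟩ : ∃ y, y = √((m:ℝ)+1) := ⟨_, rfl⟩
    have hx0 : 0 < x := by rw [hx]; positivity
    have hy0 : 0 < y := by rw [hy]; positivity
    have hx2 : x^2 = m := by rw [hx]; exact Real.sq_sqrt (by positivity)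
    have hy2 : y^2 = m+1 := by rw [hy]; exact Real.sq_sqrt (by positivity)
    rw [← hx, ← hy, ← hx2]
    have hxy : x ≤ y := by nlinarith
    have e2 : 1/x - 1/y = 1 / (x*(x*y+y^2)) := by
      field_simp; nlinarith
    rw [e2]
    apply one_div_le_one_div_of_le (by positivity)
    nlinarith [mul_pos hx0 hy0, mul_pos hx0 (mul_pos hx0 hy0)]
  have := mul_le_mul_of_nonneg_left key hc
  have h0 : 0 ≤ √(2/π) * (1/((m:ℝ) * √(m:ℝ))) := by positivity
  rw [abs_le]
  constructor <;> linarith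
end

section
/- Σ_{k=1}^∞ k^{k−1} e^{-k} / k! = 1. -/
open Real

noncomputable def bcoef (k : ℕ) : ℝ := ((k : ℝ) + 1) ^ k / (Nat.factorial (k + 1) : ℝ)

lemma bcoef_nonneg (k : ℕ) : 0 ≤ bcoef k := by unfold bcoef; positivity

lemma bcoef_le (k : ℕ) : bcoef k ≤ Real.exp 1 ^ (k + 1) := by
  have h1 : ((k : ℝ) + 1) ^ (k + 1) / (Nat.factorial (k + 1) : ℝ) ≤ Real.exp ((k : ℝ) + 1) :=
    Real.pow_div_factorial_le_exp _ (by positivity) _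
  have h2 : Real.exp ((k : ℝ) + 1) = Real.exp 1 ^ (k + 1) := by
    rw [← Real.exp_nat_mul]; push_cast; ring_nf
  rw [← h2]
  refine le_trans ?_ h1
  unfold bcoef
  gcongr
  · have : (0 : ℝ) ≤ k := by positivity
    linarith
  · omega

lemma bcoef_summable (y : ℝ) (hy0 : 0 ≤ y) (hy : y * Real.exp 1 < 1) :
    Summable (fun k => bcoef k * y ^ (k + 1)) := by
  have hs : Summable (fun k : ℕ => (y * Real.exp 1) ^ (k + 1)) :=
    (summable_nat_add_iff 1).2 (summable_geometric_of_lt_one (by positivity) hy)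
  refine Summable.of_nonneg_of_le (fun k => mul_nonneg (bcoef_nonneg k) (by positivity)) ?_ hs
  intro k
  rw [mul_pow, mul_comm]
  exact mul_le_mul_of_nonneg_left (bcoef_le k) (by positivity)

lemma alt_sum (n : ℕ) : ∑ k ∈ Finset.range (n + 1),
    ((-1 : ℝ) ^ (n - k) * ((n + 1).choose (k + 1) : ℝ)) * ((k : ℝ) + 1) ^ n
      = if n = 0 then 1 else 0 := by
  rcases Nat.eq_zero_or_pos n with rfl | hn
  · simp
  have h := congrFun (fwdDiff_iter_pow_eq_zero_of_lt (R := ℝ) (Nat.lt_succ_self n)) 0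
  rw [fwdDiff_iter_eq_sum_shift, Finset.sum_range_succ'] at h
  simp [hn.ne'] at h ⊢
  exact h

lemma anti_sum (x : ℝ) (n : ℕ) : ∑ p ∈ Finset.HasAntidiagonal.antidiagonal n,
    bcoef p.1 * x ^ (p.1 + 1) * ((-((p.1 : ℝ) + 1) * x) ^ p.2 / (Nat.factorial p.2 : ℝ))
      = if n = 0 then x else 0 := by
  rw [Finset.Nat.sum_antidiagonal_eq_sum_range_succ_mk]
  have : ∀ k ∈ Finset.range (n + 1), bcoef k * x ^ (k + 1) *
      ((-((k : ℝ) + 1) * x) ^ (n - k) / (Nat.factorial (n - k) : ℝ))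
      = x ^ (n + 1) / (Nat.factorial (n + 1) : ℝ) *
        (((-1 : ℝ) ^ (n - k) * ((n + 1).choose (k + 1) : ℝ)) * ((k : ℝ) + 1) ^ n) := by
    intro k hk
    have hk' : k ≤ n := by simpa [Nat.lt_succ_iff] using hk
    obtain ⟨j, rfl⟩ := Nat.exists_eq_add_of_le hk'
    have hc := Nat.add_choose_mul_factorial_mul_factorial (k + 1) j
    have hc' : (((k + j + 1).choose (k + 1) : ℕ) : ℝ) * (Nat.factorial (k + 1) : ℝ)
        * (Nat.factorial j : ℝ) = (Nat.factorial (k + j + 1) : ℝ) := by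
      rw [show k + j + 1 = k + 1 + j by ring, ← hc, Nat.choose_symm_add]; push_cast; ring
    rw [Nat.add_sub_cancel_left, ← hc']
    have h1 : (Nat.factorial (k + 1) : ℝ) ≠ 0 := by positivity
    have h2 : (Nat.factorial j : ℝ) ≠ 0 := by positivity
    have h3 : (((k + j + 1).choose (k + 1) : ℕ) : ℝ) ≠ 0 := by
      exact_mod_cast (Nat.choose_pos (by omega)).ne'
    unfold bcoef
    rw [neg_mul, neg_pow, mul_pow]
    field_simp
    ring
  rw [Finset.sum_congr rfl this, ← Finset.mul_sum, alt_sum]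
  split_ifs with h
  · subst h; simp
  · simp

lemma small_x (x : ℝ) (hx0 : 0 < x) (hx : x < 1 / 10) :
    ∑' k, bcoef k * (x * Real.exp (-x)) ^ (k + 1) = x := by
  set f : ℕ × ℕ → ℝ := fun p =>
    bcoef p.1 * x ^ (p.1 + 1) * ((-((p.1 : ℝ) + 1) * x) ^ p.2 / (Nat.factorial p.2 : ℝ)) with hf
  have hexp : ∀ t : ℝ, HasSum (fun j : ℕ => t ^ j / (Nat.factorial j : ℝ)) (Real.exp t) := by
    intro t
    rw [Real.exp_eq_exp_ℝ]
    exact NormedSpace.expSeries_div_hasSum_exp t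
  have hrow : ∀ k, HasSum (fun j => f (k, j)) (bcoef k * (x * Real.exp (-x)) ^ (k + 1)) := by
    intro k
    have := (hexp (-((k : ℝ) + 1) * x)).mul_left (bcoef k * x ^ (k + 1))
    have he : bcoef k * (x * Real.exp (-x)) ^ (k + 1)
        = bcoef k * x ^ (k + 1) * Real.exp (-((k : ℝ) + 1) * x) := by
      rw [mul_pow, ← Real.exp_nat_mul]; push_cast; ring_nf
    rw [he]
    exact this
  have hrown : ∀ k, HasSum (fun j => ‖f (k, j)‖) (bcoef k * (x * Real.exp x) ^ (k + 1)) := by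
    intro k
    have := (hexp (((k : ℝ) + 1) * x)).mul_left (bcoef k * x ^ (k + 1))
    have he : bcoef k * (x * Real.exp x) ^ (k + 1)
        = bcoef k * x ^ (k + 1) * Real.exp (((k : ℝ) + 1) * x) := by
      rw [mul_pow, ← Real.exp_nat_mul]; push_cast; ring_nf
    have hfe : (fun j => ‖f (k, j)‖) = fun j : ℕ => bcoef k * x ^ (k + 1) *
        ((((k : ℝ) + 1) * x) ^ j / (Nat.factorial j : ℝ)) := by
      funext j
      have := bcoef_nonneg k
      have h4 : |(k : ℝ) + 1| = k + 1 := abs_of_nonneg (by positivity)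
      simp only [hf, Real.norm_eq_abs, abs_mul, abs_div, abs_pow, abs_neg, abs_of_nonneg this,
        abs_of_pos hx0, h4, Nat.abs_cast]
    rw [he, hfe]
    exact this
  have hsum : Summable f := by
    apply Summable.of_norm
    rw [summable_prod_of_nonneg (fun _ => norm_nonneg _)]
    refine ⟨fun k => (hrown k).summable, ?_⟩
    simp_rw [fun k => (hrown k).tsum_eq]
    apply bcoef_summable _ (by positivity)
    have h1 : Real.exp 1 < 3 := by linarith [Real.exp_one_lt_d9]
    have h2 : Real.exp x ≤ Real.exp 1 := Real.exp_le_exp.2 (by linarith)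
    have h0 := Real.exp_pos x
    nlinarith [mul_pos hx0 h0, mul_lt_mul'' hx (h2.trans_lt h1) hx0.le h0.le]
  have e1 : ∑' p, f p = ∑' k, bcoef k * (x * Real.exp (-x)) ^ (k + 1) := by
    rw [hsum.tsum_prod]
    exact tsum_congr fun k => (hrow k).tsum_eq
  have h5 := (Finset.HasAntidiagonal.sigmaAntidiagonalEquivProd (A := ℕ)).hasSum_iff.2 hsum.hasSum
  have h6 := h5.sigma (fun n => hasSum_fintype _)
  have h7 : HasSum (fun n : ℕ => if n = 0 then x else 0) (∑' p, f p) := by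
    convert h6 using 1
    funext n
    rw [← anti_sum x n, ← Finset.sum_coe_sort]
    rfl
  rw [← e1]
  exact h7.unique (hasSum_ite_eq 0 x)

lemma key_lt (x : ℝ) (hx : x < 1) : x * Real.exp (-x) < Real.exp (-1) := by
  have h := Real.add_one_lt_exp (x := x - 1) (by linarith)
  have h2 : Real.exp (-1) = Real.exp (x - 1) * Real.exp (-x) := by
    rw [← Real.exp_add]; ring_nf
  rw [h2]
  exact mul_lt_mul_of_pos_right (by linarith) (Real.exp_pos _)

lemma all_x (x : ℝ) (hx0 : 0 < x) (hx : x < 1) :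
    ∑' k, bcoef k * (x * Real.exp (-x)) ^ (k + 1) = x := by
  set p := FormalMultilinearSeries.ofScalars ℝ bcoef with hp
  have hr : ENNReal.ofReal (Real.exp (-1)) ≤ p.radius := by
    refine p.le_radius_of_bound (r := (Real.exp (-1)).toNNReal) (Real.exp 1) fun n => ?_
    rw [hp, FormalMultilinearSeries.ofScalars_norm, Real.coe_toNNReal _ (Real.exp_pos _).le,
      Real.norm_of_nonneg (bcoef_nonneg n)]
    calc bcoef n * Real.exp (-1) ^ n ≤ Real.exp 1 ^ (n + 1) * Real.exp (-1) ^ n :=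
          mul_le_mul_of_nonneg_right (bcoef_le n) (by positivity)
      _ = Real.exp 1 * (Real.exp 1 * Real.exp (-1)) ^ n := by rw [mul_pow]; ring
      _ = Real.exp 1 := by rw [← Real.exp_add]; simp
  have hpos : 0 < p.radius := lt_of_lt_of_le (by simpa using Real.exp_pos (-1)) hr
  have hG := (p.hasFPowerSeriesOnBall hpos).analyticOnNhd
  have hF : ∀ x : ℝ, ∑' k, bcoef k * (x * Real.exp (-x)) ^ (k + 1)
      = (x * Real.exp (-x)) * p.sum (x * Real.exp (-x)) := by
    intro x
    have : p.sum (x * Real.exp (-x)) = ∑' k, bcoef k * (x * Real.exp (-x)) ^ k := by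
      have := FormalMultilinearSeries.ofScalars_sum_eq (E := ℝ) bcoef (x * Real.exp (-x))
      simpa [FormalMultilinearSeries.ofScalarsSum] using this
    rw [this, ← tsum_mul_left]
    exact tsum_congr fun k => by ring
  have han : AnalyticOnNhd ℝ (fun x : ℝ => (x * Real.exp (-x)) * p.sum (x * Real.exp (-x)))
      (Set.Ioo 0 1) := by
    intro y hy
    have ha : AnalyticAt ℝ (fun x : ℝ => x * Real.exp (-x)) y := by fun_prop
    refine ha.mul ?_
    refine AnalyticAt.fun_comp (g := p.sum) (f := fun x : ℝ => x * Real.exp (-x)) (hG _ ?_) ha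
    rw [Metric.mem_eball, edist_zero_right]
    refine lt_of_lt_of_le ?_ hr
    have h0 : 0 < y * Real.exp (-y) := mul_pos hy.1 (Real.exp_pos _)
    rw [← ofReal_norm, Real.norm_of_nonneg h0.le]
    exact (ENNReal.ofReal_lt_ofReal_iff (Real.exp_pos _)).2 (key_lt y hy.2)
  have := han.eqOn_of_preconnected_of_eventuallyEq (g := fun x => x) (fun y _ => analyticAt_id)
    isPreconnected_Ioo (z₀ := 1 / 20) ⟨by norm_num, by norm_num⟩ (by
      filter_upwards [Ioo_mem_nhds (show (0 : ℝ) < 1 / 20 by norm_num)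
        (show (1 / 20 : ℝ) < 1 / 10 by norm_num)] with y hy
      rw [← hF, small_x y hy.1 hy.2])
  rw [hF]
  exact this ⟨hx0, hx⟩

lemma borel_main : ∑' k, bcoef k * (Real.exp (-1)) ^ (k + 1) = 1 := by
  have hs : ∀ x : ℝ, 0 < x → x < 1 →
      Summable (fun k => bcoef k * (x * Real.exp (-x)) ^ (k + 1)) := by
    intro x h0 h1
    apply bcoef_summable _ (by positivity)
    have := mul_lt_mul_of_pos_right (key_lt x h1) (Real.exp_pos 1)
    rwa [← Real.exp_add, neg_add_cancel, Real.exp_zero] at this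
  have hI : Set.Ioo (0 : ℝ) 1 ∈ nhdsWithin 1 (Set.Iio 1) := Ioo_mem_nhdsLT (by norm_num)
  have hnn : ∀ k, 0 ≤ bcoef k * (Real.exp (-1)) ^ (k + 1) :=
    fun k => mul_nonneg (bcoef_nonneg k) (by positivity)
  have hpart : ∀ u : Finset ℕ, ∑ k ∈ u, bcoef k * (Real.exp (-1)) ^ (k + 1) ≤ 1 := by
    intro u
    have hc : Continuous (fun x : ℝ => ∑ k ∈ u, bcoef k * (x * Real.exp (-x)) ^ (k + 1)) := by
      fun_prop
    have ht := (hc.tendsto 1).mono_left (nhdsWithin_le_nhds (s := Set.Iio 1))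
    simp only [one_mul] at ht
    refine le_of_tendsto ht ?_
    filter_upwards [hI] with x hx
    refine ((hs x hx.1 hx.2).sum_le_tsum u fun k _ => mul_nonneg (bcoef_nonneg k) ?_).trans ?_
    · have := hx.1
      positivity
    · rw [all_x x hx.1 hx.2]; exact hx.2.le
  have hsum : Summable (fun k => bcoef k * (Real.exp (-1)) ^ (k + 1)) :=
    summable_of_sum_le hnn hpart
  refine le_antisymm (hsum.tsum_le_of_sum_le hpart) ?_
  refine le_of_forall_lt_imp_le_of_dense fun a ha => ?_
  have ha' : max a (1 / 2) < 1 := max_lt ha (by norm_num)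
  have h0 : 0 < max a (1 / 2) := lt_max_of_lt_right (by norm_num)
  refine (le_max_left a (1 / 2)).trans ?_
  rw [← all_x _ h0 ha']
  refine (hs _ h0 ha').tsum_le_tsum (fun k => ?_) hsum
  exact mul_le_mul_of_nonneg_left
    (pow_le_pow_left₀ (by positivity) (key_lt _ ha').le _) (bcoef_nonneg k)

theorem stmt_9 :
    ∑' k : ℕ, ((k + 1 : ℕ) : ℝ) ^ ((k + 1) - 1) * Real.exp (-((k + 1 : ℕ) : ℝ)) /
      (Nat.factorial (k + 1)) = 1 := by
  rw [← borel_main]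
  refine tsum_congr fun k => ?_
  rw [← Real.exp_nat_mul, Nat.add_sub_cancel]
  unfold bcoef
  push_cast
  rw [mul_neg_one]
  ring
end

section
/- Fix λ ∈ ℝ. Let Ψ : [0,∞) → ℝ be a continuous function such that Ψ(t) = 1 + (π/8)^{1/2} t + O(t²) as t → 0⁺ and Ψ(t) = O(t² e^{t²/24}) as t → ∞. Let F(x,λ) := x³/6 − λx²/2 + λ²x/2. Then, as ε → 0⁺, ∫_ε^∞ (2π)^{-1/2} x^{-5/2} Ψ(x^{3/2}) e^{-F(x,λ)} dx = (2/(9π))^{1/2} ε^{-3/2} − (2π)^{-1/2} λ² ε^{-1/2} + (1/4) ln(1/ε) + O(1). -/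
open Real MeasureTheory Filter Asymptotics

lemma aux_exp_s11 (l : ℝ) : ∃ C δ : ℝ, 0 ≤ C ∧ 0 < δ ∧ ∀ x : ℝ, 0 < x → x < δ → x ≤ 1 →
    |Real.exp (-(x ^ 3 / 6 - l * x ^ 2 / 2 + l ^ 2 * x / 2)) - (1 - l ^ 2 * x / 2)| ≤ C * x ^ 2 := by
  set M : ℝ := 1 / 6 + |l| / 2 + l ^ 2 / 2 with hM
  have hMp : 0 < M := by positivity
  refine ⟨M ^ 2 + (1 / 6 + |l| / 2), 1 / M, by positivity, by positivity, ?_⟩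
  intro x hx hxd hx1
  have h1 : |x ^ 3 / 6 - l * x ^ 2 / 2| ≤ (1 / 6 + |l| / 2) * x ^ 2 := by
    have e : x ^ 3 / 6 - l * x ^ 2 / 2 = (x / 6 - l / 2) * x ^ 2 := by ring
    rw [e, abs_mul, abs_of_nonneg (sq_nonneg x)]
    gcongr
    rw [abs_le]
    constructor <;> linarith [le_abs_self l, neg_abs_le l]
  have h2 : |-(x ^ 3 / 6 - l * x ^ 2 / 2 + l ^ 2 * x / 2)| ≤ M * x := by
    rw [abs_neg]
    refine (abs_add_le _ _).trans ?_
    rw [abs_of_nonneg (by positivity : 0 ≤ l ^ 2 * x / 2)]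
    have : (1 / 6 + |l| / 2) * x ^ 2 ≤ (1 / 6 + |l| / 2) * x := by
      gcongr
      nlinarith
    rw [hM]; linarith
  have h3 : M * x ≤ 1 := by
    rw [lt_div_iff₀ hMp] at hxd; linarith
  have h4 := Real.abs_exp_sub_one_sub_id_le (h2.trans h3)
  set u := -(x ^ 3 / 6 - l * x ^ 2 / 2 + l ^ 2 * x / 2) with hu
  have h5 : u ^ 2 ≤ (M * x) ^ 2 := by
    rw [← sq_abs u]; gcongr
  have e : Real.exp u - (1 - l ^ 2 * x / 2) =
      (Real.exp u - 1 - u) + -(x ^ 3 / 6 - l * x ^ 2 / 2) := by rw [hu]; ring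
  rw [e]
  refine (abs_add_le _ _).trans ?_
  rw [abs_neg]
  nlinarith

lemma aux_local (l : ℝ) (Ψ : ℝ → ℝ) (a : ℝ) (ha : 0 ≤ a)
    (hPsiZero : (fun t => Ψ t - (1 + a * t)) =O[nhdsWithin 0 (Set.Ioi 0)] fun t => t ^ 2) :
    ∃ C δ : ℝ, 0 ≤ C ∧ 0 < δ ∧ ∀ x : ℝ, 0 < x → x ≤ δ →
    |Ψ (x ^ ((3/2 : ℝ))) * Real.exp (-(x ^ 3 / 6 - l * x ^ 2 / 2 + l ^ 2 * x / 2)) -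
      (1 + a * x ^ (3/2 : ℝ) - l ^ 2 * x / 2)| ≤ C * x ^ 2 := by
  obtain ⟨C2, d2, hC2, hd2, H2⟩ := aux_exp_s11 l
  obtain ⟨C1, hC1, hb⟩ := hPsiZero.exists_nonneg
  rw [isBigOWith_iff, eventually_nhdsWithin_iff, Metric.eventually_nhds_iff] at hb
  obtain ⟨d1, hd1, H1⟩ := hb
  refine ⟨C1 + (1 + a) * C2 + a * l ^ 2 / 2, min (min (d1 / 2) (d2 / 2)) 1, by positivity,
    by positivity, ?_⟩
  intro x hx hxd
  have hx1 : x ≤ 1 := hxd.trans (min_le_right _ _)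
  have hxd1 : x < d1 := by
    have := (hxd.trans (min_le_left _ _)).trans (min_le_left _ _); linarith
  have hxd2 : x < d2 := by
    have := (hxd.trans (min_le_left _ _)).trans (min_le_right _ _); linarith
  set s := x ^ (3/2 : ℝ) with hs
  have hs0 : 0 < s := Real.rpow_pos_of_pos hx _
  have hsx : s ≤ x := by
    calc s ≤ x ^ (1 : ℝ) := Real.rpow_le_rpow_of_exponent_ge hx hx1 (by norm_num)
      _ = x := Real.rpow_one x
  have hs2 : s ^ 2 = x ^ 3 := by
    rw [hs, ← Real.rpow_natCast, ← Real.rpow_mul hx.le, ← Real.rpow_natCast]; norm_num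
  have k1 : |Ψ s - (1 + a * s)| ≤ C1 * x ^ 2 := by
    have := H1 (y := s) (by rw [Real.dist_eq, sub_zero, abs_of_pos hs0]; linarith) hs0
    rw [Real.norm_eq_abs, Real.norm_eq_abs, abs_of_nonneg (sq_nonneg s), hs2] at this
    refine this.trans ?_
    gcongr ?_ * ?_
    nlinarith [sq_nonneg x]
  have k2 := H2 x hx hxd2 hx1
  set E := Real.exp (-(x ^ 3 / 6 - l * x ^ 2 / 2 + l ^ 2 * x / 2)) with hE
  have hE1 : |E| ≤ 1 := by
    rw [hE, abs_of_pos (Real.exp_pos _), Real.exp_le_one_iff]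
    nlinarith [mul_nonneg hx.le (sq_nonneg (x - 2 * l)), pow_pos hx 3]
  have e : Ψ s * E - (1 + a * s - l ^ 2 * x / 2) =
      (Ψ s - (1 + a * s)) * E + (1 + a * s) * (E - (1 - l ^ 2 * x / 2)) +
        -(a * l ^ 2 / 2 * (s * x)) := by ring
  rw [e]
  refine (abs_add_three _ _ _).trans ?_
  rw [abs_mul, abs_mul, abs_neg, abs_of_nonneg (by positivity : 0 ≤ 1 + a * s),
    abs_of_nonneg (by positivity : 0 ≤ a * l ^ 2 / 2 * (s * x))]
  have t1 : |Ψ s - (1 + a * s)| * |E| ≤ (C1 * x ^ 2) * 1 := by gcongr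
  have t2 : (1 + a * s) * |E - (1 - l ^ 2 * x / 2)| ≤ (1 + a) * (C2 * x ^ 2) := by
    gcongr
    nlinarith
  have t3 : a * l ^ 2 / 2 * (s * x) ≤ a * l ^ 2 / 2 * (x ^ 2) := by
    gcongr; nlinarith
  linarith

lemma aux_cont (l c : ℝ) (Ψ : ℝ → ℝ) (hPsiCont : ContinuousOn Ψ (Set.Ici 0)) :
    ContinuousOn (fun x : ℝ => c * x ^ (-(5/2 : ℝ)) * Ψ (x ^ ((3/2 : ℝ))) *
            Real.exp (-(x ^ 3 / 6 - l * x ^ 2 / 2 + l ^ 2 * x / 2))) (Set.Ioi 0) := by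
  have h1 : ContinuousOn (fun x : ℝ => x ^ (-(5/2 : ℝ))) (Set.Ioi 0) :=
    fun x hx => (Real.continuousAt_rpow_const x _ (Or.inl (ne_of_gt hx))).continuousWithinAt
  have h2 : ContinuousOn (fun x : ℝ => x ^ (3/2 : ℝ)) (Set.Ioi 0) :=
    fun x hx => (Real.continuousAt_rpow_const x _ (Or.inl (ne_of_gt hx))).continuousWithinAt
  have h3 : ContinuousOn (fun x : ℝ => Ψ (x ^ (3/2 : ℝ))) (Set.Ioi 0) :=
    hPsiCont.comp h2 (fun x hx => Real.rpow_nonneg (le_of_lt hx) _)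
  have h4 : Continuous (fun x : ℝ =>
    Real.exp (-(x ^ 3 / 6 - l * x ^ 2 / 2 + l ^ 2 * x / 2))) := by fun_prop
  exact ((continuousOn_const.mul h1).mul h3).mul h4.continuousOn

lemma aux_int (l c : ℝ) (Ψ : ℝ → ℝ) (hPsiCont : ContinuousOn Ψ (Set.Ici 0))
    (hPsiInf : Ψ =O[atTop] fun t => t ^ 2 * Real.exp (t ^ 2 / 24)) (ε : ℝ) (hε : 0 < ε) :
    IntegrableOn (fun x : ℝ => c * x ^ (-(5/2 : ℝ)) * Ψ (x ^ ((3/2 : ℝ))) *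
            Real.exp (-(x ^ 3 / 6 - l * x ^ 2 / 2 + l ^ 2 * x / 2))) (Set.Ioi ε) := by
  refine integrable_of_isBigO_exp_neg (b := 1) one_pos
    ((aux_cont l c Ψ hPsiCont).mono (fun x hx => lt_of_lt_of_le hε hx)) ?_
  obtain ⟨C, hC, hb⟩ := hPsiInf.exists_nonneg
  rw [isBigOWith_iff] at hb
  have hb' := (tendsto_rpow_atTop (by norm_num : (0:ℝ) < 3/2)).eventually hb
  refine IsBigO.of_bound (|c| * C) ?_
  filter_upwards [hb', eventually_ge_atTop 1, eventually_ge_atTop (2 * l + 4)] with x h hx1 hx2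
  have hx : 0 < x := by linarith
  have hs2 : (x ^ (3/2 : ℝ)) ^ 2 = x ^ 3 := by
    rw [← Real.rpow_natCast, ← Real.rpow_mul hx.le, ← Real.rpow_natCast]; norm_num
  rw [hs2] at h
  simp only [Real.norm_eq_abs] at h ⊢
  rw [abs_mul, abs_mul, abs_mul, Real.abs_exp, Real.abs_exp,
    abs_of_pos (Real.rpow_pos_of_pos hx (-(5/2)))]
  rw [abs_mul, Real.abs_exp, abs_of_pos (pow_pos hx 3)] at h
  have hr : x ^ (-(5/2 : ℝ)) * x ^ 3 ≤ Real.exp x := by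
    rw [← Real.rpow_natCast x 3, ← Real.rpow_add hx]
    calc _ ≤ x ^ (1 : ℝ) := Real.rpow_le_rpow_of_exponent_le hx1 (by norm_num)
      _ = x := Real.rpow_one x
      _ ≤ Real.exp x := by linarith [Real.add_one_le_exp x]
  have hexp : Real.exp x * (Real.exp (x ^ 3 / 24) *
      Real.exp (-(x ^ 3 / 6 - l * x ^ 2 / 2 + l ^ 2 * x / 2))) ≤ Real.exp (-1 * x) := by
    rw [← Real.exp_add, ← Real.exp_add, Real.exp_le_exp]
    have : x * 16 ≤ x * (x - 2 * l) ^ 2 := by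
      gcongr; nlinarith
    nlinarith
  calc |c| * x ^ (-(5/2 : ℝ)) * |Ψ (x ^ (3/2 : ℝ))| *
        Real.exp (-(x ^ 3 / 6 - l * x ^ 2 / 2 + l ^ 2 * x / 2))
      ≤ |c| * x ^ (-(5/2 : ℝ)) * (C * (x ^ 3 * Real.exp (x ^ 3 / 24))) *
        Real.exp (-(x ^ 3 / 6 - l * x ^ 2 / 2 + l ^ 2 * x / 2)) := by gcongr
    _ = |c| * C * ((x ^ (-(5/2 : ℝ)) * x ^ 3) * (Real.exp (x ^ 3 / 24) *
        Real.exp (-(x ^ 3 / 6 - l * x ^ 2 / 2 + l ^ 2 * x / 2)))) := by ring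
    _ ≤ |c| * C * (Real.exp x * (Real.exp (x ^ 3 / 24) *
        Real.exp (-(x ^ 3 / 6 - l * x ^ 2 / 2 + l ^ 2 * x / 2)))) := by gcongr
    _ ≤ |c| * C * Real.exp (-1 * x) := by gcongr

lemma aux_deriv (c l x : ℝ) (hx : 0 < x) :
    HasDerivAt (fun x : ℝ => -(2/3 * c * x ^ (-(3/2 : ℝ))) + c * l ^ 2 * x ^ (-(1/2 : ℝ)) +
      1/4 * Real.log x)
      (c * x ^ (-(5/2 : ℝ)) - c * l ^ 2 / 2 * x ^ (-(3/2 : ℝ)) + 1/4 * x⁻¹) x := by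
  have h1 := (Real.hasDerivAt_rpow_const (x := x) (p := -(3/2 : ℝ)) (Or.inl hx.ne')).const_mul (2/3 * c)
  have h2 := (Real.hasDerivAt_rpow_const (x := x) (p := -(1/2 : ℝ)) (Or.inl hx.ne')).const_mul (c * l ^ 2)
  have h3 := (Real.hasDerivAt_log hx.ne').const_mul (1/4 : ℝ)
  refine ((h1.neg.add h2).add h3).congr_deriv ?_
  rw [show (-(3/2 : ℝ) - 1) = -(5/2) by norm_num, show (-(1/2 : ℝ) - 1) = -(3/2) by norm_num]
  ring

theorem stmt_11 (l : ℝ) (Ψ : ℝ → ℝ)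
    (hPsiCont : ContinuousOn Ψ (Set.Ici 0))
    (hPsiZero : (fun t => Ψ t - (1 + (π / 8) ^ ((1/2 : ℝ)) * t)) =O[nhdsWithin 0 (Set.Ioi 0)]
      fun t => t ^ 2)
    (hPsiInf : Ψ =O[atTop] fun t => t ^ 2 * Real.exp (t ^ 2 / 24)) :
    (fun ε : ℝ =>
        (∫ x in Set.Ioi ε,
          (2 * π) ^ (-(1/2 : ℝ)) * x ^ (-(5/2 : ℝ)) * Ψ (x ^ ((3/2 : ℝ))) *
            Real.exp (-(x ^ 3 / 6 - l * x ^ 2 / 2 + l ^ 2 * x / 2))) -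
        ((2 / (9 * π)) ^ ((1/2 : ℝ)) * ε ^ (-(3/2 : ℝ)) -
          (2 * π) ^ (-(1/2 : ℝ)) * l ^ 2 * ε ^ (-(1/2 : ℝ)) +
          (1/4) * Real.log (1 / ε)))
      =O[nhdsWithin 0 (Set.Ioi 0)] fun _ => (1 : ℝ) := by
  have hpi := Real.pi_pos
  have hca : (2 * π) ^ (-(1/2 : ℝ)) * (π / 8) ^ ((1/2 : ℝ)) = 1 / 4 := by
    rw [Real.rpow_neg (by positivity), ← Real.inv_rpow (by positivity),
      ← Real.mul_rpow (by positivity) (by positivity),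
      show (2 * π)⁻¹ * (π / 8) = (1/4) ^ 2 by field_simp; norm_num,
      ← Real.sqrt_eq_rpow, Real.sqrt_sq (by norm_num)]
  have hc2 : (2 / (9 * π)) ^ ((1/2 : ℝ)) = 2 / 3 * (2 * π) ^ (-(1/2 : ℝ)) := by
    rw [Real.rpow_neg (by positivity), ← Real.inv_rpow (by positivity),
      show 2 / (9 * π) = (2 / 3) ^ 2 * (2 * π)⁻¹ by field_simp; norm_num,
      Real.mul_rpow (by positivity) (by positivity), ← Real.sqrt_eq_rpow,
      Real.sqrt_sq (by norm_num)]
  have ha : 0 ≤ (π / 8) ^ ((1/2 : ℝ)) := by positivity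
  have hc : 0 ≤ (2 * π) ^ (-(1/2 : ℝ)) := by positivity
  rw [hc2]
  set c := (2 * π) ^ (-(1/2 : ℝ)) with hcdef
  set a := (π / 8) ^ ((1/2 : ℝ)) with hadef
  obtain ⟨C, δ, hC, hδ, H⟩ := aux_local l Ψ a ha hPsiZero
  have hint := aux_int l c Ψ hPsiCont hPsiInf
  set g : ℝ → ℝ := fun x => c * x ^ (-(5/2 : ℝ)) * Ψ (x ^ ((3/2 : ℝ))) *
            Real.exp (-(x ^ 3 / 6 - l * x ^ 2 / 2 + l ^ 2 * x / 2)) with hg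
  set P : ℝ → ℝ := fun x : ℝ => -(2/3 * c * x ^ (-(3/2 : ℝ))) + c * l ^ 2 * x ^ (-(1/2 : ℝ)) +
      1/4 * Real.log x with hP
  set p : ℝ → ℝ := fun x => c * x ^ (-(5/2 : ℝ)) - c * l ^ 2 / 2 * x ^ (-(3/2 : ℝ)) + 1/4 * x⁻¹
    with hp
  have hbound : ∀ x, 0 < x → x ≤ δ → |g x - p x| ≤ c * C * x ^ (-(1/2 : ℝ)) := by
    intro x hx hxd
    have h := H x hx hxd
    have r1 : x ^ (-(5/2 : ℝ)) * x ^ (3/2 : ℝ) = x⁻¹ := by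
      rw [← Real.rpow_add hx, ← Real.rpow_neg_one]; norm_num
    have r2 : x ^ (-(5/2 : ℝ)) * x = x ^ (-(3/2 : ℝ)) := by
      nth_rewrite 2 [← Real.rpow_one x]
      rw [← Real.rpow_add hx]; norm_num
    have r3 : x ^ (-(5/2 : ℝ)) * x ^ 2 = x ^ (-(1/2 : ℝ)) := by
      rw [← Real.rpow_natCast x 2, ← Real.rpow_add hx]; norm_num
    have e : g x - p x = c * x ^ (-(5/2 : ℝ)) * (Ψ (x ^ ((3/2 : ℝ))) *
        Real.exp (-(x ^ 3 / 6 - l * x ^ 2 / 2 + l ^ 2 * x / 2)) -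
      (1 + a * x ^ (3/2 : ℝ) - l ^ 2 * x / 2)) := by
      simp only [hg, hp]
      rw [← r1, ← r2, ← hca]; ring
    rw [e, abs_mul, abs_of_nonneg (by positivity : 0 ≤ c * x ^ (-(5/2 : ℝ)))]
    calc _ ≤ c * x ^ (-(5/2 : ℝ)) * (C * x ^ 2) := by gcongr
      _ = c * C * x ^ (-(1/2 : ℝ)) := by rw [← r3]; ring
  refine IsBigO.of_bound (|∫ x in Set.Ioi δ, g x| + |P δ| + c * C * (2 * δ ^ (1/2 : ℝ))) ?_
  filter_upwards [Ioo_mem_nhdsGT hδ] with ε hε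
  obtain ⟨hε0, hεδ⟩ := hε
  have hgi : IntervalIntegrable g volume ε δ := by
    rw [intervalIntegrable_iff_integrableOn_Ioc_of_le hεδ.le]
    exact (hint ε hε0).mono_set Set.Ioc_subset_Ioi_self
  have hrc : ∀ r : ℝ, ContinuousOn (fun x : ℝ => x ^ r) (Set.uIcc ε δ) := by
    intro r x hx
    rw [Set.uIcc_of_le hεδ.le] at hx
    exact (Real.continuousAt_rpow_const x _
      (Or.inl (ne_of_gt (lt_of_lt_of_le hε0 hx.1)))).continuousWithinAt
  have hpi' : IntervalIntegrable p volume ε δ := by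
    apply ContinuousOn.intervalIntegrable
    have hinv : ContinuousOn (fun x : ℝ => x⁻¹) (Set.uIcc ε δ) := by
      refine (hrc (-1)).congr fun x _ => ?_
      exact (Real.rpow_neg_one x).symm
    exact ((continuousOn_const.mul (hrc _)).sub (continuousOn_const.mul (hrc _))).add
      (continuousOn_const.mul hinv)
  have hsplit : (∫ x in Set.Ioi ε, g x) = (∫ x in ε..δ, g x) + ∫ x in Set.Ioi δ, g x := 
    (intervalIntegral.integral_interval_add_Ioi (hint ε hε0) (hint δ hδ)).symm
  have hFTC : (∫ x in ε..δ, p x) = P δ - P ε := by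
    apply intervalIntegral.integral_eq_sub_of_hasDerivAt _ hpi'
    intro x hx
    rw [Set.uIcc_of_le hεδ.le] at hx
    exact aux_deriv c l x (lt_of_lt_of_le hε0 hx.1)
  have hsub : (∫ x in ε..δ, g x) = (∫ x in ε..δ, (g x - p x)) + (∫ x in ε..δ, p x) := by
    rw [intervalIntegral.integral_sub hgi hpi']; ring
  have hb : |∫ x in ε..δ, (g x - p x)| ≤ c * C * (2 * δ ^ (1/2 : ℝ)) := by
    have h1 : ‖∫ x in ε..δ, (g x - p x)‖ ≤ ∫ x in ε..δ, c * C * x ^ (-(1/2 : ℝ)) := by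
      apply intervalIntegral.norm_integral_le_of_norm_le hεδ.le
      · filter_upwards with x hx
        exact hbound x (hε0.trans hx.1) hx.2
      · exact (continuousOn_const.mul (hrc _)).intervalIntegrable
    rw [Real.norm_eq_abs] at h1
    refine h1.trans ?_
    rw [intervalIntegral.integral_const_mul, integral_rpow (Or.inl (by norm_num))]
    have : 0 ≤ ε ^ (1/2 : ℝ) := by positivity
    rw [show (-(1/2 : ℝ) + 1) = 1/2 by norm_num]
    gcongr
    linarith
  have key : (∫ x in Set.Ioi ε, g x) - (2 / 3 * c * ε ^ (-(3/2 : ℝ)) -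
      c * l ^ 2 * ε ^ (-(1/2 : ℝ)) + (1/4) * Real.log (1 / ε)) =
      (∫ x in Set.Ioi δ, g x) + P δ + ∫ x in ε..δ, (g x - p x) := by
    rw [hsplit, hsub, hFTC, one_div ε, Real.log_inv]
    simp only [hP]; ring
  rw [key, norm_one, mul_one, Real.norm_eq_abs]
  refine (abs_add_three _ _ _).trans ?_
  linarith
end

section
/- Let Ψ : [0,∞) → (0,∞) be a continuous function with Ψ(t) / ((t²/2) e^{t²/24}) → 1 as t → ∞. Let F(x,λ) := x³/6 − λx²/2 + λ²x/2, and set Λ_λ(x) := (2π)^{-1/2} x^{-5/2} Ψ(x^{3/2}) e^{-F(x,λ)} and φ_λ(x) := (λ/(4π))^{1/2} e^{-λ(x−2λ)²/4}. Then ∫_λ^∞ |Λ_λ(x) − φ_λ(x)| dx → 0 as λ → +∞. -/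
open Real MeasureTheory Filter

lemma aux_fact (Ψ : ℝ → ℝ) (x l : ℝ) (hx : 0 < x) :
    (2 * π) ^ (-(1/2 : ℝ)) * x ^ (-(5/2 : ℝ)) * Ψ (x ^ ((3/2 : ℝ))) *
            Real.exp (-(x ^ 3 / 6 - l * x ^ 2 / 2 + l ^ 2 * x / 2)) =
    (Ψ (x ^ (3/2 : ℝ)) / (((x ^ (3/2 : ℝ)) ^ 2 / 2) * Real.exp ((x ^ (3/2 : ℝ)) ^ 2 / 24))) *
      (√(x / (8 * π)) * Real.exp (-x * (x - 2 * l) ^ 2 / 8)) := by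
  have h1 : (x ^ (3/2 : ℝ)) ^ 2 = x ^ 3 := by
    rw [← Real.rpow_natCast, ← Real.rpow_mul hx.le, ← Real.rpow_natCast]
    norm_num
  have h2 : x ^ (-(5/2 : ℝ)) = √x / x ^ 3 := by
    rw [Real.sqrt_eq_rpow, ← Real.rpow_natCast, ← Real.rpow_sub hx]
    norm_num
  have h3 : (2 * π) ^ (-(1/2 : ℝ)) = 1 / √(2 * π) := by
    rw [Real.rpow_neg (by positivity), Real.sqrt_eq_rpow, inv_eq_one_div]
  have h4 : √(x / (8 * π)) = √x / (2 * √(2 * π)) := by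
    rw [Real.sqrt_div hx.le, show 8 * π = 2 ^ 2 * (2 * π) by ring,
      Real.sqrt_mul (by positivity), Real.sqrt_sq (by norm_num)]
  have h5 : Real.exp (-(x ^ 3 / 6 - l * x ^ 2 / 2 + l ^ 2 * x / 2)) =
      Real.exp (-x * (x - 2 * l) ^ 2 / 8) / Real.exp (x ^ 3 / 24) := by
    rw [← Real.exp_sub]; congr 1; ring
  rw [h1, h2, h3, h4, h5]
  have : 0 < √(2 * π) := by positivity
  field_simp

lemma aux_main (Ψ : ℝ → ℝ) (hc : Continuous Ψ)
    (hpos : ∀ t : ℝ, 0 ≤ t → 0 < Ψ t)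
    (hinf : Tendsto (fun t => Ψ t / ((t ^ 2 / 2) * Real.exp (t ^ 2 / 24))) atTop (nhds 1)) :
    Tendsto
      (fun l : ℝ => ∫ x in Set.Ioi l,
        |(2 * π) ^ (-(1/2 : ℝ)) * x ^ (-(5/2 : ℝ)) * Ψ (x ^ ((3/2 : ℝ))) *
            Real.exp (-(x ^ 3 / 6 - l * x ^ 2 / 2 + l ^ 2 * x / 2)) -
          (l / (4 * π)) ^ ((1/2 : ℝ)) * Real.exp (-l * (x - 2 * l) ^ 2 / 4)|)
      atTop (nhds 0) := by
  set r : ℝ → ℝ := fun t => Ψ t / ((t ^ 2 / 2) * Real.exp (t ^ 2 / 24)) with hr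
  have hrm : Measurable r := by
    have := hc.measurable
    fun_prop
  let u : ℝ → ℝ → ℝ := fun l y => 2 + (√l)⁻¹ ^ 3 * y
  let K : ℝ → ℝ → ℝ := fun l y => Set.indicator {y | 1 < u l y} (fun y =>
    |r ((2 * l + (√l)⁻¹ * y) ^ (3/2 : ℝ)) * (√(u l y / (8 * π)) * Real.exp (-u l y * y ^ 2 / 8)) -
      √(1 / (4 * π)) * Real.exp (-y ^ 2 / 4)|) y
  have hKm : ∀ l, Measurable (K l) := by
    intro l
    refine Measurable.indicator ?_ ?_
    · simp only [u]; fun_prop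
    · have : Measurable (u l) := by simp only [u]; fun_prop
      exact measurableSet_lt measurable_const this
  -- change of variables
  have hcv : ∀ l : ℝ, 0 < l → (∫ x in Set.Ioi l,
        |(2 * π) ^ (-(1/2 : ℝ)) * x ^ (-(5/2 : ℝ)) * Ψ (x ^ ((3/2 : ℝ))) *
            Real.exp (-(x ^ 3 / 6 - l * x ^ 2 / 2 + l ^ 2 * x / 2)) -
          (l / (4 * π)) ^ ((1/2 : ℝ)) * Real.exp (-l * (x - 2 * l) ^ 2 / 4)|) = ∫ y, K l y := by
    intro l hl
    rw [← integral_indicator measurableSet_Ioi]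
    set f := Set.indicator (Set.Ioi l) (fun x : ℝ => |(2 * π) ^ (-(1/2 : ℝ)) * x ^ (-(5/2 : ℝ)) *
            Ψ (x ^ ((3/2 : ℝ))) *
            Real.exp (-(x ^ 3 / 6 - l * x ^ 2 / 2 + l ^ 2 * x / 2)) -
          (l / (4 * π)) ^ ((1/2 : ℝ)) * Real.exp (-l * (x - 2 * l) ^ 2 / 4)|) with hf
    have hs : 0 < √l := Real.sqrt_pos.2 hl
    have hss : √l ^ 2 = l := Real.sq_sqrt hl.le
    have e1 : ∫ x, f x = ∫ x, f (2 * l + x) := (integral_add_left_eq_self f (2 * l)).symm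
    have e2 := Measure.integral_comp_mul_left (fun x => f (2 * l + x)) ((√l)⁻¹)
    have e3 : ∫ x, f x = ∫ y, (√l)⁻¹ * f (2 * l + (√l)⁻¹ * y) := by
      rw [integral_const_mul, e2, e1, inv_inv, abs_of_pos hs, smul_eq_mul, ← mul_assoc,
        inv_mul_cancel₀ hs.ne', one_mul]
    rw [e3]
    congr 1
    ext y
    generalize hcc : (√l)⁻¹ = c
    have hc0 : 0 < c := by rw [← hcc]; positivity
    have hcl : c ^ 2 * l = 1 := by
      rw [← hcc, inv_pow, hss]; exact inv_mul_cancel₀ hl.ne'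
    have hu : u l y = c ^ 2 * (2 * l + c * y) := by
      simp only [u, hcc]; linear_combination (-2) * hcl
    have hiff : 1 < u l y ↔ l < 2 * l + c * y := by
      rw [hu, ← hcl]
      exact mul_lt_mul_iff_right₀ (by positivity)
    by_cases h : l < 2 * l + c * y
    · have h' := hiff.2 h
      simp only [K]
      rw [hf, Set.indicator_of_mem (by exact h), Set.indicator_of_mem (by exact h')]
      rw [aux_fact Ψ _ l (hl.trans h), hcc]
      rw [← abs_of_pos hc0, ← abs_mul, abs_of_pos hc0, mul_sub]
      congr 2
      · have a1 : √(u l y / (8 * π)) = c * √((2 * l + c * y) / (8 * π)) := by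
          rw [hu, mul_div_assoc, Real.sqrt_mul (by positivity), Real.sqrt_sq hc0.le]
        have a2 : -u l y * y ^ 2 / 8 = -(2 * l + c * y) * (2 * l + c * y - 2 * l) ^ 2 / 8 := by
          rw [hu]; ring
        rw [a1, a2]
        simp only [hr]
        ring
      · have a1 : √(1 / (4 * π)) = c * (l / (4 * π)) ^ (1/2 : ℝ) := by
          rw [← Real.sqrt_eq_rpow, ← hcl, mul_div_assoc, Real.sqrt_mul (by positivity),
            Real.sqrt_sq hc0.le]
        have a2 : -y ^ 2 / 4 = -l * (2 * l + c * y - 2 * l) ^ 2 / 4 := by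
          linear_combination (y ^ 2 / 4) * hcl
        rw [a1, a2]
        ring
    · have h' := mt hiff.1 h
      simp only [K]
      rw [hf, Set.indicator_of_notMem (by exact h), Set.indicator_of_notMem (by exact h'), mul_zero]
  have htop : Tendsto (fun x : ℝ => x ^ (3/2 : ℝ)) atTop atTop := tendsto_rpow_atTop (by norm_num)
  have hrx := hinf.comp htop
  have hinv : Tendsto (fun l : ℝ => (√l)⁻¹) atTop (nhds 0) :=
    tendsto_inv_atTop_zero.comp Real.tendsto_sqrt_atTop
  have hut : ∀ y, Tendsto (fun l => u l y) atTop (nhds 2) := by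
    intro y
    have := ((hinv.pow 3).mul_const y).const_add 2
    simpa [u] using this
  suffices hS : Tendsto (fun l => ∫ y, K l y) atTop (nhds (∫ y : ℝ, (0:ℝ))) by
    rw [integral_zero] at hS
    refine hS.congr' ?_
    filter_upwards [eventually_gt_atTop 0] with l hl
    exact (hcv l hl).symm
  refine tendsto_integral_filter_of_dominated_convergence
    (fun y => 2 * ((3 + |y|) * Real.exp (-(1/8) * y ^ 2)) + √(1 / (4 * π)) * Real.exp (-(1/4) * y ^ 2))
    ?_ ?_ ?_ ?_
  · exact Eventually.of_forall fun l => (hKm l).aestronglyMeasurable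
  · have h2 : ∀ᶠ x in atTop, r (x ^ (3/2 : ℝ)) < 2 := hrx.eventually_lt_const (by norm_num)
    obtain ⟨L, hL⟩ := eventually_atTop.1 h2
    filter_upwards [eventually_ge_atTop L, eventually_ge_atTop 1] with l hlL hl1
    refine Eventually.of_forall fun y => ?_
    have hs : 1 ≤ √l := by rw [Real.one_le_sqrt]; exact hl1
    have hss : √l ^ 2 = l := Real.sq_sqrt (by linarith)
    simp only [K]
    by_cases h : 1 < u l y
    · rw [Set.indicator_of_mem (by exact h)]
      have hc0 : 0 < (√l)⁻¹ := by positivity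
      have hc1 : (√l)⁻¹ ≤ 1 := inv_le_one_of_one_le₀ hs
      have hcl : (√l)⁻¹ ^ 2 * l = 1 := by
        rw [inv_pow, hss]; exact inv_mul_cancel₀ (by linarith)
      have hx : l < 2 * l + (√l)⁻¹ * y := by
        have hu : u l y = (√l)⁻¹ ^ 2 * (2 * l + (√l)⁻¹ * y) := by
          simp only [u]; linear_combination (-2) * hcl
        rw [hu, ← hcl] at h
        exact (mul_lt_mul_iff_right₀ (by positivity)).1 h
      have hr2 := (hL _ (hlL.trans hx.le)).le
      have hr0 : 0 ≤ r ((2 * l + (√l)⁻¹ * y) ^ (3/2 : ℝ)) := by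
        have hp : 0 ≤ (2 * l + (√l)⁻¹ * y) ^ (3/2 : ℝ) := Real.rpow_nonneg (by linarith) _
        have := (hpos _ hp).le
        simp only [hr]
        positivity
      have huy : u l y ≤ 2 + |y| := by
        have : (√l)⁻¹ ^ 3 * y ≤ 1 * |y| := by
            calc (√l)⁻¹ ^ 3 * y ≤ (√l)⁻¹ ^ 3 * |y| := by gcongr; exact le_abs_self y
              _ ≤ 1 * |y| := by gcongr; exact pow_le_one₀ hc0.le hc1
        simp only [u]; linarith
      have hsq : √(u l y / (8 * π)) ≤ 3 + |y| := by
        have hy := abs_nonneg y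
        apply Real.sqrt_le_iff.2 ⟨by positivity, ?_⟩
        have : u l y / (8 * π) ≤ u l y :=
          div_le_self (by linarith) (by linarith [Real.pi_gt_three])
        nlinarith
      have hexp : Real.exp (-u l y * y ^ 2 / 8) ≤ Real.exp (-(1/8) * y ^ 2) := by
        apply Real.exp_le_exp.2
        nlinarith [sq_nonneg y]
      rw [Real.norm_eq_abs, abs_abs]
      refine (abs_sub _ _).trans ?_
      rw [abs_of_nonneg (by positivity), abs_of_nonneg (by positivity),
        show -y ^ 2 / 4 = -(1/4) * y ^ 2 by ring]
      gcongr
    · rw [Set.indicator_of_notMem (by exact h), norm_zero]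
      positivity
  · have g1 : Integrable (fun y : ℝ => Real.exp (-(1/8) * y ^ 2)) :=
      integrable_exp_neg_mul_sq (by norm_num)
    have g2 : Integrable (fun y : ℝ => Real.exp (-(1/4) * y ^ 2)) :=
      integrable_exp_neg_mul_sq (by norm_num)
    have g3 : Integrable (fun y : ℝ => |y| * Real.exp (-(1/8) * y ^ 2)) := by
      have := (integrable_mul_exp_neg_mul_sq (b := 1/8) (by norm_num)).abs
      simpa [abs_mul] using this
    have := (((g1.const_mul 3).add g3).const_mul 2).add (g2.const_mul (√(1 / (4 * π))))
    refine this.congr (Eventually.of_forall fun y => ?_)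
    simp only [Pi.add_apply]
    ring
  · refine Eventually.of_forall fun y => ?_
    have hxt : Tendsto (fun l : ℝ => 2 * l + (√l)⁻¹ * y) atTop atTop := by
      refine Tendsto.atTop_add (C := 0 * y) ?_ (hinv.mul_const y)
      exact tendsto_id.const_mul_atTop (by norm_num)
    have q1 := hrx.comp hxt
    have q2 := ((hut y).div_const (8 * π)).sqrt
    have q3 := (Real.continuous_exp.tendsto _).comp ((((hut y).neg).mul_const (y ^ 2)).div_const 8)
    have q := ((q1.mul (q2.mul q3)).sub_const (√(1 / (4 * π)) * Real.exp (-y ^ 2 / 4))).abs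
    have z : |1 * (√(2 / (8 * π)) * Real.exp (-2 * y ^ 2 / 8)) -
        √(1 / (4 * π)) * Real.exp (-y ^ 2 / 4)| = 0 := by
      rw [show (2 : ℝ) / (8 * π) = 1 / (4 * π) by field_simp; norm_num,
        show -2 * y ^ 2 / 8 = -y ^ 2 / 4 by ring]
      simp
    rw [z] at q
    refine q.congr' ?_
    filter_upwards [(hut y).eventually_const_lt (show (1:ℝ) < 2 by norm_num)] with l hl
    simp only [K]
    rw [Set.indicator_of_mem (by exact hl)]
    rfl

theorem stmt_12 (Ψ : ℝ → ℝ)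
    (hPsiCont : ContinuousOn Ψ (Set.Ici 0))
    (hPsiPos : ∀ t : ℝ, 0 ≤ t → 0 < Ψ t)
    (hPsiInf : Tendsto (fun t => Ψ t / ((t ^ 2 / 2) * Real.exp (t ^ 2 / 24))) atTop (nhds 1)) :
    Tendsto
      (fun l : ℝ => ∫ x in Set.Ioi l,
        |(2 * π) ^ (-(1/2 : ℝ)) * x ^ (-(5/2 : ℝ)) * Ψ (x ^ ((3/2 : ℝ))) *
            Real.exp (-(x ^ 3 / 6 - l * x ^ 2 / 2 + l ^ 2 * x / 2)) -
          (l / (4 * π)) ^ ((1/2 : ℝ)) * Real.exp (-l * (x - 2 * l) ^ 2 / 4)|)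
      atTop (nhds 0) := by
  have h := aux_main (fun t => Ψ (max 0 t))
    (hPsiCont.comp_continuous (by fun_prop) (fun t => le_max_left 0 t))
    (fun t _ => hPsiPos _ (le_max_left 0 t))
    (hPsiInf.congr' (by
      filter_upwards [eventually_ge_atTop 0] with t ht
      simp only [max_eq_right ht]))
  refine h.congr' ?_
  filter_upwards [eventually_gt_atTop 0] with l hl
  refine setIntegral_congr_fun measurableSet_Ioi fun x hx => ?_
  have hx0 : 0 ≤ x ^ (3/2 : ℝ) := Real.rpow_nonneg (hl.trans hx).le _
  simp only [max_eq_right hx0]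
end

section
/- Let Ψ : [0,∞) → (0,∞) be a continuous function with Ψ(t) → 1 as t → 0⁺ and Ψ(t) ≤ C e^{t²/6} for all t ≥ 0 and some constant C. Let F(x,λ) := x³/6 − λx²/2 + λ²x/2 and Λ_λ(x) := (2π)^{-1/2} x^{-5/2} Ψ(x^{3/2}) e^{-F(x,λ)}. For λ < −e define a(λ) := 3 ln|λ| − (5/2) ln ln|λ| − (1/2) ln(2⁴·3⁵·π). Then for every fixed s ∈ ℝ, ∫_{(2/λ²)(a(λ)+s)}^∞ Λ_λ(x) dx → e^{-s} as λ → −∞. -/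
open Real MeasureTheory Filter

theorem aux_cov (g : ℝ → ℝ) (r A : ℝ) (hr : 0 < r) :
    ∫ x in Set.Ioi (r * A), g x = ∫ u in Set.Ioi (0:ℝ), r * g (r * (A + u)) := by
  have h1 := integral_comp_mul_left_Ioi g A hr
  have h2 : ∫ u in Set.Ioi (0:ℝ), g (r * (A + u)) = ∫ y in Set.Ioi A, g (r * y) := by
    have h := (measurePreserving_add_left (volume : Measure ℝ) A).setIntegral_preimage_emb
      (measurableEmbedding_addLeft A) (fun y => g (r * y)) (Set.Ioi A)
    simpa using h
  rw [integral_const_mul, h2, h1, smul_eq_mul, mul_inv_cancel_left₀ hr.ne']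

/-- the centering plus s -/
noncomputable def auxA (s t : ℝ) : ℝ :=
  (3 * Real.log t - (5/2) * Real.log (Real.log t) -
              (1/2) * Real.log (2 ^ 4 * 3 ^ 5 * π)) + s

theorem auxA_div (s u : ℝ) : Tendsto (fun t => (auxA s t + u) / Real.log t) atTop (nhds 3) := by
  have h1 : Tendsto (fun t => Real.log (Real.log t) / Real.log t) atTop (nhds 0) :=
    (Real.isLittleO_log_id_atTop.tendsto_div_nhds_zero).comp Real.tendsto_log_atTop
  have h2 : Tendsto (fun t => (-(1/2) * Real.log (2 ^ 4 * 3 ^ 5 * π) + s + u) / Real.log t)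
      atTop (nhds 0) := tendsto_const_nhds.div_atTop Real.tendsto_log_atTop
  have h3 : Tendsto (fun t => 3 - (5/2) * (Real.log (Real.log t) / Real.log t) +
      (-(1/2) * Real.log (2 ^ 4 * 3 ^ 5 * π) + s + u) / Real.log t) atTop (nhds 3) := by
    simpa using (tendsto_const_nhds.sub (h1.const_mul (5/2))).add h2
  refine h3.congr' ?_
  filter_upwards [eventually_gt_atTop 1] with t ht
  have := Real.log_pos ht
  unfold auxA
  field_simp
  ring

theorem auxA_pos (s : ℝ) : ∀ᶠ t in atTop, 0 < auxA s t := by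
  filter_upwards [(auxA_div s 0).eventually (lt_mem_nhds (show (0:ℝ) < 3 by norm_num)),
    eventually_gt_atTop 1] with t h ht
  have := Real.log_pos ht
  have h' := mul_pos h this
  rw [div_mul_cancel₀ _ this.ne'] at h'
  simpa using h'

theorem aux_x (s u : ℝ) :
    Tendsto (fun t => 2 / t ^ 2 * (auxA s t + u)) atTop (nhds 0) := by
  have h1 : Tendsto (fun t : ℝ => Real.log t / t) atTop (nhds 0) :=
    Real.isLittleO_log_id_atTop.tendsto_div_nhds_zero
  have h2 : Tendsto (fun t : ℝ => 2 / t) atTop (nhds 0) :=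
    tendsto_const_nhds.div_atTop tendsto_id
  have h3 := (h2.mul h1).mul (auxA_div s u)
  simp only [zero_mul] at h3
  refine h3.congr' ?_
  filter_upwards [eventually_gt_atTop 1] with t ht
  have := Real.log_pos ht
  have : 0 < t := by linarith
  field_simp

theorem aux_tx (s u : ℝ) :
    Tendsto (fun t => t * (2 / t ^ 2 * (auxA s t + u)) ^ 2 / 2) atTop (nhds 0) := by
  have h1 : Tendsto (fun t : ℝ => Real.log t ^ 2 / t) atTop (nhds 0) :=
    Real.isLittleO_pow_log_id_atTop.tendsto_div_nhds_zero
  have h2 : Tendsto (fun t : ℝ => 2 / t ^ 2) atTop (nhds 0) :=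
    tendsto_const_nhds.div_atTop (tendsto_pow_atTop two_ne_zero)
  have h3 := (h2.mul h1).mul ((auxA_div s u).pow 2)
  simp only [zero_mul] at h3
  refine h3.congr' ?_
  filter_upwards [eventually_gt_atTop 1] with t ht
  have := Real.log_pos ht
  have : 0 < t := by linarith
  field_simp

/-- prefactor -/
noncomputable def auxK (s t : ℝ) : ℝ :=
  Real.exp (-s) * (auxA s t / Real.log t / 3) ^ (-(5/2 : ℝ))

theorem auxK_lim (s : ℝ) : Tendsto (auxK s) atTop (nhds (Real.exp (-s))) := by
  have h := (auxA_div s 0).div_const 3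
  simp only [add_zero] at h
  have h2 := h.rpow_const (p := -(5/2:ℝ)) (Or.inl (by norm_num))
  have h3 := h2.const_mul (Real.exp (-s))
  have e : auxK s = fun t => Real.exp (-s) * (auxA s t / Real.log t / 3) ^ (-(5/2 : ℝ)) := rfl
  rw [e]
  simpa using h3

theorem auxK_eq (s t : ℝ) (ht : 1 < t) (hA : 0 < auxA s t) :
    2 / t ^ 2 * ((2 * π) ^ (-(1/2 : ℝ)) * (2 / t ^ 2) ^ (-(5/2 : ℝ)) *
      (auxA s t) ^ (-(5/2 : ℝ)) * Real.exp (-auxA s t)) = auxK s t := by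
  have hL := Real.log_pos ht
  have ht0 : 0 < t := by linarith
  have hr : 0 < 2 / t ^ 2 := by positivity
  have hp := Real.pi_pos
  have e1 : 2 / t ^ 2 = Real.exp (Real.log 2 - 2 * Real.log t) := by
    rw [Real.exp_sub, Real.exp_log two_pos, mul_comm, Real.exp_mul, Real.exp_log ht0]
    norm_num
  have e2 : Real.log (2 ^ 4 * 3 ^ 5 * π) = 4 * Real.log 2 + 5 * Real.log 3 + Real.log π := by
    rw [Real.log_mul (by positivity) hp.ne', Real.log_mul (by positivity) (by positivity),
      Real.log_pow, Real.log_pow]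
    norm_num
  unfold auxK
  rw [Real.rpow_def_of_pos (by positivity : 0 < 2 * π), Real.rpow_def_of_pos hr,
    Real.rpow_def_of_pos hA, Real.rpow_def_of_pos (by positivity),
    Real.log_div (x := auxA s t / Real.log t) (by positivity) (by norm_num), Real.log_div hA.ne' hL.ne',
    Real.log_mul two_ne_zero hp.ne', e1, Real.log_exp]
  simp only [← Real.exp_add]
  congr 1
  have : auxA s t = (3 * Real.log t - (5/2) * Real.log (Real.log t) -
              (1/2) * (4 * Real.log 2 + 5 * Real.log 3 + Real.log π)) + s := by
    rw [← e2]; rfl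
  generalize Real.log (auxA s t) = z
  rw [this]
  ring

/-- normalized integrand -/
noncomputable def auxH (Ψ : ℝ → ℝ) (s t u : ℝ) : ℝ :=
  ((auxA s t + u) / auxA s t) ^ (-(5/2 : ℝ)) *
    (Ψ ((2 / t ^ 2 * (auxA s t + u)) ^ (3/2 : ℝ)) *
      Real.exp (-((2 / t ^ 2 * (auxA s t + u)) ^ 3 / 6)) *
      Real.exp (-(t * (2 / t ^ 2 * (auxA s t + u)) ^ 2 / 2))) * Real.exp (-u)

theorem aux_integrand (Ψ : ℝ → ℝ) (s t u : ℝ) (ht : 1 < t) (hA : 0 < auxA s t) (hu : 0 < u) :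
    2 / t ^ 2 * ((2 * π) ^ (-(1/2 : ℝ)) * (2 / t ^ 2 * (auxA s t + u)) ^ (-(5/2 : ℝ)) *
      Ψ ((2 / t ^ 2 * (auxA s t + u)) ^ (3/2 : ℝ)) *
      Real.exp (-((2 / t ^ 2 * (auxA s t + u)) ^ 3 / 6 - (-t) * (2 / t ^ 2 * (auxA s t + u)) ^ 2 / 2
        + (-t) ^ 2 * (2 / t ^ 2 * (auxA s t + u)) / 2))) = auxK s t * auxH Ψ s t u := by
  have ht0 : 0 < t := by linarith
  rw [← auxK_eq s t ht hA]
  unfold auxH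
  have e1 : (2 / t ^ 2 * (auxA s t + u)) ^ (-(5/2 : ℝ)) = (2 / t ^ 2) ^ (-(5/2 : ℝ)) *
      ((auxA s t) ^ (-(5/2 : ℝ)) * ((auxA s t + u) / auxA s t) ^ (-(5/2 : ℝ))) := by
    rw [← Real.mul_rpow hA.le (by positivity), ← Real.mul_rpow (by positivity) (by positivity)]
    congr 2
    field_simp
  have e2 : Real.exp (-((2 / t ^ 2 * (auxA s t + u)) ^ 3 / 6
        - (-t) * (2 / t ^ 2 * (auxA s t + u)) ^ 2 / 2
        + (-t) ^ 2 * (2 / t ^ 2 * (auxA s t + u)) / 2)) =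
      Real.exp (-((2 / t ^ 2 * (auxA s t + u)) ^ 3 / 6)) *
      Real.exp (-(t * (2 / t ^ 2 * (auxA s t + u)) ^ 2 / 2)) * Real.exp (-u) *
      Real.exp (-auxA s t) := by
    simp only [← Real.exp_add]
    congr 1
    field_simp
    ring
  rw [e1, e2]
  ring

theorem auxH_lim (Ψ : ℝ → ℝ) (C : ℝ)
    (hPsiCont : ContinuousOn Ψ (Set.Ici 0))
    (hPsiPos : ∀ t : ℝ, 0 ≤ t → 0 < Ψ t)
    (hPsiOne : Tendsto Ψ (nhdsWithin 0 (Set.Ioi 0)) (nhds 1))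
    (hPsiBound : ∀ t : ℝ, 0 ≤ t → Ψ t ≤ C * Real.exp (t ^ 2 / 6))
    (s : ℝ) : Tendsto (fun t => ∫ u in Set.Ioi (0:ℝ), auxH Ψ s t u) atTop (nhds 1) := by
  rw [← integral_exp_neg_Ioi_zero]
  refine tendsto_integral_filter_of_dominated_convergence (fun u => C * Real.exp (-u)) ?_ ?_ ?_ ?_
  · filter_upwards [eventually_gt_atTop 1, auxA_pos s] with t ht hA
    have ht0 : 0 < t := by linarith
    refine ContinuousOn.aestronglyMeasurable ?_ measurableSet_Ioi
    have hc : ContinuousOn (fun u => Ψ ((2 / t ^ 2 * (auxA s t + u)) ^ (3/2 : ℝ)))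
        (Set.Ioi 0) := by
      refine hPsiCont.comp ?_ ?_
      · refine ContinuousOn.rpow_const (by fun_prop) ?_
        intro u hu; right; norm_num
      · intro u hu
        have : (0:ℝ) < u := hu
        exact Real.rpow_nonneg (by positivity) _
    have hc2 : ContinuousOn (fun u => ((auxA s t + u) / auxA s t) ^ (-(5/2 : ℝ))) (Set.Ioi 0) := by
      refine ContinuousOn.rpow_const (by fun_prop) ?_
      intro u hu; left
      have : (0:ℝ) < u := hu
      positivity
    unfold auxH
    exact (hc2.mul ((hc.mul (by fun_prop)).mul (by fun_prop))).mul (by fun_prop)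
  · filter_upwards [eventually_gt_atTop 1, auxA_pos s] with t ht hA
    have ht0 : 0 < t := by linarith
    filter_upwards [ae_restrict_mem measurableSet_Ioi] with u hu
    have hu : (0:ℝ) < u := hu
    unfold auxH
    set x := 2 / t ^ 2 * (auxA s t + u) with hx
    have hx0 : 0 < x := by positivity
    have hx1 : 0 ≤ x ^ (3/2:ℝ) := by positivity
    have hP := hPsiPos _ hx1
    have hB := hPsiBound _ hx1
    have e : (x ^ (3/2:ℝ)) ^ 2 = x ^ 3 := by
      rw [← Real.rpow_natCast, ← Real.rpow_mul hx0.le, ← Real.rpow_natCast]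
      norm_num
    rw [e] at hB
    have b1 : ((auxA s t + u) / auxA s t) ^ (-(5/2 : ℝ)) ≤ 1 := by
      apply Real.rpow_le_one_of_one_le_of_nonpos
      · rw [one_le_div hA]; linarith
      · norm_num
    have b2 : Ψ (x ^ (3/2:ℝ)) * Real.exp (-(x ^ 3 / 6)) ≤ C := by
      calc _ ≤ C * Real.exp (x ^ 3 / 6) * Real.exp (-(x ^ 3 / 6)) := by gcongr
        _ = C := by rw [mul_assoc, ← Real.exp_add]; simp
    have b3 : Real.exp (-(t * x ^ 2 / 2)) ≤ 1 := by
      rw [Real.exp_le_one_iff]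
      have : 0 < t * x ^ 2 / 2 := by positivity
      linarith
    have hC : 0 ≤ C := le_trans (by positivity) b2
    rw [Real.norm_of_nonneg (by positivity)]
    gcongr
    calc _ ≤ 1 * (C * 1) := by gcongr
      _ = C := by ring
  · exact (integrableOn_exp_neg_Ioi 0).const_mul C
  · filter_upwards [ae_restrict_mem measurableSet_Ioi] with u hu
    have hu : (0:ℝ) < u := hu
    have hx := aux_x s u
    have hx0 : ∀ᶠ t in atTop, 0 < 2 / t ^ 2 * (auxA s t + u) := by
      filter_upwards [eventually_gt_atTop 1, auxA_pos s] with t ht hA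
      have ht0 : 0 < t := by linarith
      positivity
    have l1 : Tendsto (fun t => ((auxA s t + u) / auxA s t) ^ (-(5/2 : ℝ))) atTop (nhds 1) := by
      have h := (auxA_div s u).div (auxA_div s 0) (by norm_num)
      have h2 : Tendsto (fun t => (auxA s t + u) / auxA s t) atTop (nhds 1) := by
        rw [div_self (by norm_num)] at h
        refine h.congr' ?_
        filter_upwards [eventually_gt_atTop 1, auxA_pos s] with t ht hA
        have := Real.log_pos ht
        simp only [Pi.div_apply, add_zero]
        field_simp
      have := h2.rpow_const (p := -(5/2:ℝ)) (Or.inl (by norm_num))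
      simpa using this
    have l2 : Tendsto (fun t => Ψ ((2 / t ^ 2 * (auxA s t + u)) ^ (3/2 : ℝ))) atTop (nhds 1) := by
      refine hPsiOne.comp (tendsto_nhdsWithin_iff.2 ⟨?_, ?_⟩)
      · have := hx.rpow_const (p := (3/2:ℝ)) (Or.inr (by norm_num))
        rwa [Real.zero_rpow (by norm_num)] at this
      · filter_upwards [hx0] with t h
        exact Real.rpow_pos_of_pos h _
    have l3 : Tendsto (fun t => Real.exp (-((2 / t ^ 2 * (auxA s t + u)) ^ 3 / 6)))
        atTop (nhds 1) := by
      have := (Real.continuous_exp.tendsto _).comp ((hx.pow 3).div_const 6).neg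
      simpa [Function.comp_def] using this
    have l4 : Tendsto (fun t => Real.exp (-(t * (2 / t ^ 2 * (auxA s t + u)) ^ 2 / 2)))
        atTop (nhds 1) := by
      have := (Real.continuous_exp.tendsto _).comp (aux_tx s u).neg
      simpa [Function.comp_def] using this
    have := (l1.mul ((l2.mul l3).mul l4)).mul_const (Real.exp (-u))
    simpa [auxH] using this

theorem stmt_14 (Ψ : ℝ → ℝ) (C : ℝ)
    (hPsiCont : ContinuousOn Ψ (Set.Ici 0))
    (hPsiPos : ∀ t : ℝ, 0 ≤ t → 0 < Ψ t)
    (hPsiOne : Tendsto Ψ (nhdsWithin 0 (Set.Ioi 0)) (nhds 1))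
    (hPsiBound : ∀ t : ℝ, 0 ≤ t → Ψ t ≤ C * Real.exp (t ^ 2 / 6))
    (s : ℝ) :
    Tendsto
      (fun l : ℝ => ∫ x in Set.Ioi
          ((2 / l ^ 2) *
            ((3 * Real.log |l| - (5/2) * Real.log (Real.log |l|) -
              (1/2) * Real.log (2 ^ 4 * 3 ^ 5 * π)) + s)),
        (2 * π) ^ (-(1/2 : ℝ)) * x ^ (-(5/2 : ℝ)) * Ψ (x ^ ((3/2 : ℝ))) *
          Real.exp (-(x ^ 3 / 6 - l * x ^ 2 / 2 + l ^ 2 * x / 2)))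
      atBot (nhds (Real.exp (-s))) := by
  have hlim := (auxK_lim s).mul (auxH_lim Ψ C hPsiCont hPsiPos hPsiOne hPsiBound s)
  rw [mul_one] at hlim
  refine (hlim.comp tendsto_neg_atBot_atTop).congr' ?_
  filter_upwards [tendsto_neg_atBot_atTop.eventually (eventually_gt_atTop (1:ℝ)),
    tendsto_neg_atBot_atTop.eventually (auxA_pos s)] with l hl hA
  obtain ⟨t, rfl⟩ : ∃ t, l = -t := ⟨-l, by simp⟩
  simp only [Function.comp_apply, neg_neg] at hl hA ⊢
  have ht0 : 0 < t := by linarith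
  have e : (2 / (-t) ^ 2) *
            ((3 * Real.log |-t| - (5/2) * Real.log (Real.log |-t|) -
              (1/2) * Real.log (2 ^ 4 * 3 ^ 5 * π)) + s) = 2 / t ^ 2 * auxA s t := by
    rw [abs_neg, abs_of_pos ht0, neg_sq]; rfl
  rw [e, aux_cov _ _ _ (by positivity), ← integral_const_mul]
  refine setIntegral_congr_fun measurableSet_Ioi ?_
  intro u hu
  exact (aux_integrand Ψ s t u hl hA hu).symm
end

section
/- There is a constant C such that for every real μ with 1/2 ≤ μ ≤ 3/2 and every positive integer k, b_k(μ) := k^{k−1} μ^{k−1} e^{-kμ} / k! ≤ C k^{-3/2} e^{-k(μ−1)²/6}. -/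
open Real

theorem aux_exp_s15 (μ : ℝ) (h1 : 1/2 ≤ μ) (h2 : μ ≤ 3/2) :
    μ ≤ Real.exp ((μ - 1) - (μ - 1)^2/6) := by
  obtain ⟨t, rfl⟩ : ∃ t, μ = 1 + t := ⟨μ - 1, by ring⟩
  have e : (1 + t - 1) - (1 + t - 1)^2/6 = t - t^2/6 := by ring
  rw [e]
  rcases le_total 0 t with ht | ht
  · have hu : 0 ≤ t - t^2/6 := by nlinarith
    have := Real.quadratic_le_exp_of_nonneg hu
    have h3 : (t - t^2/6)^2 ≥ t^2/3 := by
      have : (1 - t/6)^2 ≥ 1/3 := by nlinarith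
      nlinarith [mul_le_mul_of_nonneg_left this (sq_nonneg t)]
    linarith
  · obtain ⟨s, rfl⟩ : ∃ s, t = -s := ⟨-t, by ring⟩
    obtain ⟨v, hv⟩ : ∃ v, v = s + s^2/6 := ⟨_, rfl⟩
    have hu : -s - (-s)^2/6 = -v := by rw [hv]; ring
    rw [hu]
    have hs : 0 ≤ s := by linarith
    have hs2 : s ≤ 1/2 := by linarith
    have hv0 : s ≤ v := by nlinarith
    have hv1 : v ≤ 3/5 := by nlinarith
    have hb := Real.exp_bound (x := -v) (by rw [abs_neg, abs_of_nonneg (by linarith)]; linarith)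
      (n := 3) (by norm_num)
    rw [abs_neg, abs_of_nonneg (by linarith : 0 ≤ v)] at hb
    have hb := (abs_le.mp hb).1
    norm_num [Finset.sum_range_succ, Nat.factorial] at hb
    have h3 : v^3 ≤ 3/5 * v^2 := by nlinarith [mul_nonneg (sub_nonneg.2 hv1) (sq_nonneg v)]
    have h4 : s^2 ≤ v^2 := by nlinarith
    nlinarith

theorem stmt_15 :
    ∃ C : ℝ, ∀ μ : ℝ, 1/2 ≤ μ → μ ≤ 3/2 → ∀ k : ℕ, 0 < k →
      borelPMF k μ ≤ C * (k : ℝ) ^ (-(3/2 : ℝ)) * Real.exp (-(k : ℝ) * (μ - 1) ^ 2 / 6) := by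
  refine ⟨2, fun μ h1 h2 k hk => ?_⟩
  have hK : (0:ℝ) < k := by exact_mod_cast hk
  have hμ : 0 < μ := by linarith
  have hS := Stirling.le_factorial_stirling k
  have hS2 : √(k:ℝ) * (k / exp 1) ^ k ≤ (Nat.factorial k : ℝ) := by
    refine le_trans ?_ hS
    gcongr
    nlinarith [Real.pi_gt_three]
  have hp : μ ^ k ≤ exp (k * ((μ - 1) - (μ - 1)^2/6)) := by
    rw [Real.exp_nat_mul]
    exact pow_le_pow_left₀ hμ.le (aux_exp_s15 μ h1 h2) k
  have hr : (k:ℝ) ^ (-(3/2 : ℝ)) = 1 / (k * √(k:ℝ)) := by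
    rw [Real.rpow_neg hK.le, show (3/2:ℝ) = 1 + 1/2 by norm_num, Real.rpow_add hK, Real.rpow_one,
      Real.sqrt_eq_rpow, one_div, one_div]
  have hE : exp (-(k : ℝ) * (μ - 1) ^ 2 / 6) =
      exp (k * ((μ - 1) - (μ - 1)^2/6)) * exp (-(k:ℝ) * μ) * exp 1 ^ k := by
    rw [← Real.exp_nat_mul, ← Real.exp_add, ← Real.exp_add]
    congr 1; ring
  have hs : 0 < √(k:ℝ) := Real.sqrt_pos.2 hK
  unfold borelPMF
  rw [hr, hE]
  have hk1 : (k:ℝ) ^ (k-1) = k^k / k := by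
    rw [eq_div_iff hK.ne', ← pow_succ, Nat.sub_add_cancel hk]
  have hm1 : μ ^ (k-1) = μ^k / μ := by
    rw [eq_div_iff hμ.ne', ← pow_succ, Nat.sub_add_cancel hk]
  rw [hk1, hm1]
  have hmu : μ^k / μ ≤ 2 * exp (k * ((μ - 1) - (μ - 1)^2/6)) := by
    rw [div_le_iff₀ hμ]
    nlinarith [exp_pos (k * ((μ - 1) - (μ - 1)^2/6))]
  have hpos : 0 < √(k:ℝ) * (k / exp 1) ^ k := by positivity
  calc (k:ℝ)^k / k * (μ^k / μ) * exp (-(k:ℝ) * μ) / (Nat.factorial k)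
      ≤ (k:ℝ)^k / k * (2 * exp (k * ((μ - 1) - (μ - 1)^2/6))) * exp (-(k:ℝ) * μ) /
        (√(k:ℝ) * (k / exp 1) ^ k) := by gcongr
    _ = _ := by
      rw [div_pow]
      field_simp
end

section
/- Fix λ ∈ ℝ with λ ≠ 0 and ε > 0, and let b_k(μ) := k^{k−1} μ^{k−1} e^{-kμ} / k!. Then there exist a constant C and an integer N such that for all integers n ≥ N and all integers k with ε n^{2/3} ≤ k ≤ (n^{1/3}/|λ|)^{5/2}, | b_k(1 + λ n^{-1/3}) − (2π)^{-1/2} k^{-3/2} e^{-λ² k n^{-2/3}/2} | ≤ C n^{-1/6} k^{-3/2} e^{-λ² k n^{-2/3}/2}. If λ = 0, the same estimate holds for all integers k ≥ ε n^{2/3} (with no upper restriction on k). -/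
open Real

open Filter Topology in
lemma stir_aux (m : ℕ) : Real.log (Stirling.stirlingSeq (m+1)) - Real.log √π ≤ 1 / (m+1 : ℝ) := by
  have key : ∀ j : ℕ, Real.log (Stirling.stirlingSeq (m+1)) - Real.log (Stirling.stirlingSeq (m+j+1)) ≤ 1/(m+1:ℝ) - 1/(m+j+1:ℝ) := by
    intro j
    induction j with
    | zero => simp
    | succ j ih =>
      have h := Stirling.log_stirlingSeq_sdiff_le (m+j+1)
      have h2 : 1/(12*((m+j+1 : ℕ):ℝ)*(((m+j+1:ℕ):ℝ)+1)) ≤ 1/(m+j+1:ℝ) - 1/(m+j+1+1:ℝ) := by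
        push_cast
        have : (1:ℝ) ≤ m+j+1 := by
          have : (0:ℝ) ≤ m + j := by positivity
          linarith
        generalize (m+j+1:ℝ) = y at *
        rw [div_sub_div _ _ (by positivity) (by positivity), div_le_div_iff₀ (by positivity) (by positivity)]
        nlinarith
      push_cast at *
      rw [show m+(j+1)+1 = m+j+1+1 by ring, show (m+(j+1)+1:ℝ) = m+j+1+1 by ring]
      linarith
  have hp : (0:ℝ) < √π := by positivity
  have ht : Tendsto (fun j : ℕ => Real.log (Stirling.stirlingSeq (m+1)) - Real.log (Stirling.stirlingSeq (m+j+1))) atTop (𝓝 (Real.log (Stirling.stirlingSeq (m+1)) - Real.log √π)) := by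
    refine tendsto_const_nhds.sub ?_
    refine ((Real.continuousAt_log hp.ne').tendsto.comp Stirling.tendsto_stirlingSeq_sqrt_pi).comp ?_
    exact tendsto_atTop_mono (fun j => by simp; omega) tendsto_id
  refine le_of_tendsto' ht fun j => (key j).trans ?_
  have : (0:ℝ) ≤ 1/(m+j+1:ℝ) := by positivity
  linarith

lemma borel_core (k : ℕ) (hk : 1 ≤ k) (x : ℝ) (hx : |x| ≤ 1/2) :
    |borelPMF k (1+x) - (2 * π) ^ (-(1/2 : ℝ)) * (k : ℝ) ^ (-(3/2 : ℝ)) * Real.exp (-k*x^2/2)| ≤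
      ((2*k*|x|^3+2*|x|+1/k) * Real.exp (2*k*|x|^3+2*|x|+1/k)) * ((k : ℝ) ^ (-(3/2 : ℝ)) * Real.exp (-k*x^2/2)) := by
  obtain ⟨m, rfl⟩ : ∃ m, k = m+1 := ⟨k-1, by omega⟩
  set K : ℝ := ((m+1 : ℕ) : ℝ) with hK
  have hKp : 0 < K := by positivity
  have hx1 : 0 < 1 + x := by have := abs_le.1 hx; linarith
  set S := Stirling.stirlingSeq (m+1) with hS
  have hSp : 0 < S := Stirling.stirlingSeq'_pos m
  have hpi : 0 < √π := by positivity
  have h1 : Real.log √π ≤ Real.log S := Real.log_le_log hpi (Stirling.sqrt_pi_le_stirlingSeq (by simp))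
  have h2 : Real.log S - Real.log √π ≤ 1/K := by
    have := stir_aux m
    simpa [hK] using this
  -- logs
  have h3 := Real.abs_log_sub_add_sum_range_le (x := -x) (by rw [abs_neg]; linarith) 2
  have h4 := Real.abs_log_sub_add_sum_range_le (x := -x) (by rw [abs_neg]; linarith) 0
  simp [Finset.sum_range_succ] at h3 h4
  norm_num at h3 h4
  have hb : ∀ y : ℝ, 0 ≤ y → y / (1-|x|) ≤ 2 * y := by
    intro y hy
    rw [div_le_iff₀ (by linarith)]
    nlinarith
  replace h3 := h3.trans (hb _ (by positivity))
  replace h4 := h4.trans (hb _ (by positivity))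
  set L := Real.log (1+x) with hL
  set t := K * (-x + x^2/2 + L) - L + (Real.log √π - Real.log S) with ht
  set T := 2*K*|x|^3+2*|x|+1/K with hT
  have htT : |t| ≤ T := by
    have a1 : |K * (-x + x^2/2 + L)| ≤ K * (2 * |x|^3) := by
      rw [abs_mul, abs_of_pos hKp]; gcongr
    rw [abs_le] at *
    constructor <;> linarith [a1.1, a1.2, h4.1, h4.2]
  have hexp : |Real.exp t - 1| ≤ T * Real.exp T := by
    have : |Real.exp t - 1| ≤ |t| * Real.exp |t| := by
      rw [abs_le]
      have e1 := Real.add_one_le_exp t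
      have e2 := Real.add_one_le_exp (-t)
      have e3 : Real.exp t * Real.exp (-t) = 1 := by rw [← Real.exp_add]; simp
      have e4 : 1 ≤ Real.exp |t| := Real.one_le_exp (abs_nonneg _)
      have e5 := neg_abs_le t
      have e6 : Real.exp t ≤ Real.exp |t| := Real.exp_le_exp.2 (le_abs_self t)
      have e7 := le_abs_self t
      have := abs_nonneg t
      have := Real.exp_pos t
      constructor <;> nlinarith
    refine this.trans ?_
    gcongr
  have hfac : ((m+1).factorial : ℝ) = S * (√(2*K) * (K / Real.exp 1)^(m+1)) := by
    rw [hS, Stirling.stirlingSeq]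
    rw [← hK]; field_simp
  have hbor : borelPMF (m+1) (1+x) = (2 * π) ^ (-(1/2 : ℝ)) * K ^ (-(3/2 : ℝ)) * Real.exp (-K*x^2/2) * Real.exp t := by
    have p1 : (2 * π) ^ (-(1/2 : ℝ)) = (√2 * √π)⁻¹ := by
      rw [Real.rpow_neg (by positivity), ← Real.sqrt_eq_rpow, Real.sqrt_mul (by norm_num)]
    have p2 : K ^ (-(3/2 : ℝ)) = (K * √K)⁻¹ := by
      rw [Real.rpow_neg (by positivity), Real.sqrt_eq_rpow, show (3/2:ℝ) = 1 + 1/2 by norm_num, Real.rpow_add hKp, Real.rpow_one]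
    have p3 : Real.exp (-K*x^2/2) * Real.exp t = (1+x)^m * Real.exp (-K * (1+x)) * Real.exp 1 ^ (m+1) * √π / S := by
      have q1 : (1+x)^m = Real.exp (m * L) := by rw [Real.exp_nat_mul, Real.exp_log hx1]
      have q2 : Real.exp 1 ^ (m+1) = Real.exp K := by rw [← Real.exp_nat_mul, mul_one]
      have q3 : √π / S = Real.exp (Real.log √π - Real.log S) := by
        rw [Real.exp_sub, Real.exp_log hpi, Real.exp_log hSp]
      rw [mul_div_assoc _ √π, q3, q1, q2, ← Real.exp_add, ← Real.exp_add, ← Real.exp_add, ← Real.exp_add, ht]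
      have : (m:ℝ) = K - 1 := by simp [hK]
      rw [this]
      congr 1
      ring
    rw [mul_assoc, p3, p1, p2, borelPMF, hfac, ← hK, Real.sqrt_mul (by norm_num), Nat.add_sub_cancel, div_pow]
    field_simp
    ring
  rw [hbor, show (2 * π) ^ (-(1/2 : ℝ)) * K ^ (-(3/2 : ℝ)) * Real.exp (-K*x^2/2) * Real.exp t - (2 * π) ^ (-(1/2 : ℝ)) * K ^ (-(3/2 : ℝ)) * Real.exp (-K*x^2/2) = (2 * π) ^ (-(1/2 : ℝ)) * (Real.exp t - 1) * (K ^ (-(3/2 : ℝ)) * Real.exp (-K*x^2/2)) by ring, abs_mul, abs_mul,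
    abs_of_pos (show 0 < K ^ (-(3/2 : ℝ)) * Real.exp (-K*x^2/2) by positivity), abs_of_pos (show 0 < (2 * π) ^ (-(1/2 : ℝ)) by positivity)]
  have : (2 * π) ^ (-(1/2 : ℝ)) ≤ 1 := Real.rpow_le_one_of_one_le_of_nonpos (by linarith [Real.pi_gt_three]) (by norm_num)
  refine mul_le_mul_of_nonneg_right ?_ (by positivity)
  calc _ ≤ 1 * |Real.exp t - 1| := by gcongr
    _ ≤ _ := by linarith

lemma borel_main_s19 (l ε D : ℝ) (hε : 0 < ε) (hD : 0 ≤ D) : ∃ (C : ℝ) (N : ℕ), ∀ n : ℕ, N ≤ n → ∀ k : ℕ,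
      ε * (n : ℝ) ^ ((2:ℝ)/3) ≤ (k : ℝ) →
      k * |l * (n : ℝ) ^ (-(1:ℝ)/3)|^3 ≤ D * (n : ℝ) ^ (-(1:ℝ)/6) →
      |borelPMF k (1 + l * (n : ℝ) ^ (-(1:ℝ)/3)) -
          (2 * π) ^ (-(1/2 : ℝ)) * (k : ℝ) ^ (-(3/2 : ℝ)) *
            Real.exp (-(l ^ 2) * (k : ℝ) * (n : ℝ) ^ (-(2:ℝ)/3) / 2)| ≤
        C * (n : ℝ) ^ (-(1:ℝ)/6) * (k : ℝ) ^ (-(3/2 : ℝ)) *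
          Real.exp (-(l ^ 2) * (k : ℝ) * (n : ℝ) ^ (-(2:ℝ)/3) / 2) := by
  set E := 2*D+2*|l|+1/ε with hE
  have hE0 : 0 ≤ E := by positivity
  have hev : ∀ᶠ n : ℕ in Filter.atTop, |l * (n : ℝ) ^ (-(1:ℝ)/3)| ≤ 1/2 := by
    have h0 : Filter.Tendsto (fun n : ℕ => |l * (n : ℝ) ^ (-(1:ℝ)/3)|) Filter.atTop (nhds 0) := by
      have := ((tendsto_rpow_neg_atTop (show (0:ℝ) < 1/3 by norm_num)).comp tendsto_natCast_atTop_atTop).const_mul l |>.abs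
      simp only [mul_zero, abs_zero] at this
      refine this.congr fun n => ?_
      simp only [Function.comp]
      norm_num
    exact (h0.eventually (gt_mem_nhds (show (0:ℝ) < 1/2 by norm_num))).mono fun _ h => le_of_lt h
  obtain ⟨N, hN⟩ := Filter.eventually_atTop.1 hev
  refine ⟨E * Real.exp E, max N 1, fun n hn k hk1 hk2 => ?_⟩
  have hn1 : 1 ≤ n := le_trans (le_max_right _ _) hn
  have hnr : (1:ℝ) ≤ n := by exact_mod_cast hn1
  have hn0 : (0:ℝ) < n := by linarith
  have hx := hN n (le_trans (le_max_left _ _) hn)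
  set r := (n : ℝ) ^ (-(1:ℝ)/6) with hr
  have hr0 : 0 < r := by positivity
  have hr1 : r ≤ 1 := Real.rpow_le_one_of_one_le_of_nonpos hnr (by norm_num)
  have r2 : (n : ℝ) ^ (-(1:ℝ)/3) = r^2 := by
    rw [hr, ← Real.rpow_natCast, ← Real.rpow_mul hn0.le]; norm_num
  have r4 : (n : ℝ) ^ (-(2:ℝ)/3) = r^4 := by
    rw [hr, ← Real.rpow_natCast, ← Real.rpow_mul hn0.le]; norm_num
  have r4' : (n : ℝ) ^ ((2:ℝ)/3) = (r^4)⁻¹ := by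
    rw [← r4, ← Real.rpow_neg hn0.le]; norm_num
  rw [r2] at hx hk2 ⊢
  rw [r4'] at hk1
  rw [r4]
  have hkp : (0:ℝ) < k := lt_of_lt_of_le (by positivity) hk1
  have hk : 1 ≤ k := by exact_mod_cast hkp
  have hc := borel_core k hk (l * r^2) hx
  set x := l * r^2 with hxd
  rw [show -(l^2) * (k:ℝ) * r^4 / 2 = -k * x^2/2 by rw [hxd]; ring]
  refine hc.trans ?_
  have hT : 2*k*|x|^3+2*|x|+1/k ≤ E * r := by
    have a1 : |x| ≤ |l| * r := by
      rw [hxd, abs_mul, abs_of_pos (by positivity : 0 < r^2)]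
      gcongr
      nlinarith
    have a2 : 1/(k:ℝ) ≤ 1/ε * r := by
      calc 1/(k:ℝ) ≤ 1/(ε * (r^4)⁻¹) := by gcongr
        _ = 1/ε * r^4 := by field_simp
        _ ≤ 1/ε * r := by
          gcongr
          exact pow_le_of_le_one hr0.le hr1 (by norm_num)
    rw [hE]; nlinarith
  have hT2 : 2*k*|x|^3+2*|x|+1/k ≤ E := hT.trans (by nlinarith)
  rw [mul_assoc (E * Real.exp E * r)]
  refine mul_le_mul_of_nonneg_right ?_ (by positivity)
  calc _ ≤ (E * r) * Real.exp E := by gcongr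
    _ = _ := by ring


theorem stmt_19 (l ε : ℝ) (hε : 0 < ε) :
    (l ≠ 0 → ∃ (C : ℝ) (N : ℕ), ∀ n : ℕ, N ≤ n → ∀ k : ℕ,
      ε * (n : ℝ) ^ ((2:ℝ)/3) ≤ (k : ℝ) →
      (k : ℝ) ≤ ((n : ℝ) ^ ((1:ℝ)/3) / |l|) ^ ((5:ℝ)/2) →
      |borelPMF k (1 + l * (n : ℝ) ^ (-(1:ℝ)/3)) -
          (2 * π) ^ (-(1/2 : ℝ)) * (k : ℝ) ^ (-(3/2 : ℝ)) *
            Real.exp (-(l ^ 2) * (k : ℝ) * (n : ℝ) ^ (-(2:ℝ)/3) / 2)| ≤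
        C * (n : ℝ) ^ (-(1:ℝ)/6) * (k : ℝ) ^ (-(3/2 : ℝ)) *
          Real.exp (-(l ^ 2) * (k : ℝ) * (n : ℝ) ^ (-(2:ℝ)/3) / 2)) ∧
    (l = 0 → ∃ (C : ℝ) (N : ℕ), ∀ n : ℕ, N ≤ n → ∀ k : ℕ,
      ε * (n : ℝ) ^ ((2:ℝ)/3) ≤ (k : ℝ) →
      |borelPMF k (1 + l * (n : ℝ) ^ (-(1:ℝ)/3)) -
          (2 * π) ^ (-(1/2 : ℝ)) * (k : ℝ) ^ (-(3/2 : ℝ)) *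
            Real.exp (-(l ^ 2) * (k : ℝ) * (n : ℝ) ^ (-(2:ℝ)/3) / 2)| ≤
        C * (n : ℝ) ^ (-(1:ℝ)/6) * (k : ℝ) ^ (-(3/2 : ℝ)) *
          Real.exp (-(l ^ 2) * (k : ℝ) * (n : ℝ) ^ (-(2:ℝ)/3) / 2)) := by
  constructor
  · intro hl
    obtain ⟨C, N, h⟩ := borel_main_s19 l ε (|l| ^ ((1:ℝ)/2)) hε (by positivity)
    refine ⟨C, max N 1, fun n hn k hk1 hk2 => h n (le_trans (le_max_left _ _) hn) k hk1 ?_⟩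
    have hn1 : 1 ≤ n := le_trans (le_max_right _ _) hn
    have hn0 : (0:ℝ) < n := by exact_mod_cast hn1
    have hl0 : 0 < |l| := abs_pos.2 hl
    rw [abs_mul, abs_of_pos (by positivity : (0:ℝ) < (n : ℝ) ^ (-(1:ℝ)/3))]
    refine (mul_le_mul_of_nonneg_right hk2 (by positivity)).trans (le_of_eq ?_)
    rw [Real.div_rpow (by positivity) hl0.le, mul_pow, ← Real.rpow_mul hn0.le, ← Real.rpow_natCast, ← Real.rpow_natCast,
      ← Real.rpow_mul hn0.le, div_eq_mul_inv, ← Real.rpow_neg hl0.le]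
    rw [mul_comm (|l| ^ ((3:ℕ):ℝ)), mul_mul_mul_comm, ← Real.rpow_add hn0, ← Real.rpow_add hl0, mul_comm]
    norm_num
  · intro hl
    obtain ⟨C, N, h⟩ := borel_main_s19 l ε 0 hε le_rfl
    exact ⟨C, N, fun n hn k hk1 => h n hn k hk1 (by simp [hl])⟩
end
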